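/- arXiv:2506.18014 — 3 statements merged into one kernel-verified Lean document; each statement's English description precedes it below -/
import Mathlib

section
/- The set of tuples (a_0, a_1, a_2, a_3, a_4, a_5, d) of positive integers satisfying all of the following conditions is finite: (i) a_0 ≤ a_1 ≤ ... ≤ a_5 < d; (ii) a_0 + ... + a_5 = 2d; (iii) for every choice of four indices i < j < k < l from {0,...,5}, gcd(a_i, a_j, a_k, a_l) = 1; (iv) for every choice of three indices i < j < k from {0,...,5}, gcd(a_i, a_j, a_k) divides d; (v) the quasi-smoothness criterion holds: for every nonempty subset I of {0,...,5}, either d is a nonnegative integer linear combination of {a_i : i ∈ I}, or there exist at least |I| indices j ∉ I such that d − a_j is a nonnegative integer linear combination of {a_i : i ∈ I}. -/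
/-- The numerical quasi-smoothness criterion for a weighted hypersurface of
degree `d` in `P(a 0, ..., a 5)`: for every nonempty subset `I` of indices,
either `d` is a nonnegative integer combination of the weights in `I`, or
there are at least `|I|` indices `j ∉ I` with `d - a j` such a combination. -/
def QuasiSmoothCrit (a : Fin 6 → ℕ) (d : ℕ) : Prop :=
  ∀ I : Finset (Fin 6), I.Nonempty →
    (∃ c : Fin 6 → ℕ, d = ∑ i ∈ I, c i * a i) ∨
    (∃ J : Finset (Fin 6), I.card ≤ J.card ∧ Disjoint J I ∧
      ∀ j ∈ J, ∃ c : Fin 6 → ℕ, d = a j + ∑ i ∈ I, c i * a i)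

open Finset

/-- The quasi-smoothness criterion for normalized rational weights, with degree `1`. -/
def QuasiSmoothWeights (q : Fin 6 → ℚ) : Prop :=
  ∀ I : Finset (Fin 6), I.Nonempty →
    (∃ c : Fin 6 → ℕ, 1 = ∑ i ∈ I, (c i : ℚ) * q i) ∨
    (∃ J : Finset (Fin 6), I.card ≤ J.card ∧ Disjoint J I ∧
      ∀ j ∈ J, ∃ c : Fin 6 → ℕ, 1 = q j + ∑ i ∈ I, (c i : ℚ) * q i)

/-- Normalized quasi-smooth weights of total weight `2`, none exceeding `1/2`. -/
structure IsReducedWeights (q : Fin 6 → ℚ) : Prop where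
  pos : ∀ i, 0 < q i
  le_half : ∀ i, q i ≤ 1 / 2
  sum_eq : ∑ i, q i = 2
  quasiSmooth : QuasiSmoothWeights q

namespace IsReducedWeights

variable {q q' : Fin 6 → ℚ}

/-- Each variable occurs in a monomial `x_i ^ c` or `x_i ^ c * x_p` with `2 ≤ c`. -/
lemma exists_monomial (h : IsReducedWeights q) (i : Fin 6) :
    (∃ c : ℕ, 2 ≤ c ∧ (c : ℚ) * q i = 1) ∨
    (∃ p, p ≠ i ∧ ∃ c : ℕ, 2 ≤ c ∧ q p + (c : ℚ) * q i = 1) := by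
  have hi := h.pos i
  have hi' := h.le_half i
  rcases h.quasiSmooth {i} (by simp) with ⟨c, hc⟩ | ⟨J, hJ, hd, hc⟩
  · left
    rw [sum_singleton] at hc
    refine ⟨c i, ?_, hc.symm⟩
    by_contra! hlt
    have : (c i : ℚ) ≤ 1 := by exact_mod_cast Nat.lt_succ_iff.mp hlt
    nlinarith
  · obtain ⟨p, hp⟩ : J.Nonempty := by
      rw [← card_pos]
      simpa using hJ
    obtain ⟨c, hc⟩ := hc p hp
    rw [sum_singleton] at hc
    have hpi : p ≠ i := by
      rintro rfl
      simp [hp] at hd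
    have hp' := h.le_half p
    rcases Nat.lt_or_ge (c i) 2 with hlt | hge
    · left
      have : (c i : ℚ) ≤ 1 := by exact_mod_cast Nat.lt_succ_iff.mp hlt
      exact ⟨2, le_rfl, by push_cast; nlinarith⟩
    · exact Or.inr ⟨p, hpi, c i, hge, hc.symm⟩

lemma monomial_of_two_small (h : IsReducedWeights q) {j l : Fin 6} (hjl : j ≠ l)
    (hj : q j < 1 / 20) (hl : q l < 1 / 20) {i : Fin 6} (hij : i ≠ j) (hil : i ≠ l) :
    2 / 5 < q i ∧ (q i = 1 / 2 ∨ q i = (1 - q j) / 2 ∨ q i = (1 - q l) / 2) := by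
  have large : ∀ i, i ≠ j → i ≠ l → 2 / 5 < q i := by
    intro i hij hil
    have hs := h.sum_eq
    have hsub : ∑ k ∈ ({i, j, l} : Finset (Fin 6))ᶜ, q k ≤ 3 * (1 / 2) := by
      have := sum_le_card_nsmul ({i, j, l} : Finset (Fin 6))ᶜ q (1 / 2) fun k _ => h.le_half k
      rw [card_compl, card_eq_three.2 ⟨i, j, l, hij, hil, hjl, rfl⟩] at this
      simpa using this
    rw [← sum_add_sum_compl ({i, j, l} : Finset (Fin 6)), sum_insert (by simp [hij, hil]),
      sum_pair hjl] at hs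
    linarith
  have hi := large i hij hil
  refine ⟨hi, ?_⟩
  have exponent : ∀ c : ℕ, 2 ≤ c → (c : ℚ) * q i ≤ 1 → c = 2 := by
    intro c hc hle
    by_contra hne
    have : (3 : ℚ) ≤ c := by exact_mod_cast (by omega : 3 ≤ c)
    nlinarith
  rcases h.exists_monomial i with ⟨c, hc, hci⟩ | ⟨p, -, c, hc, hci⟩
  · obtain rfl := exponent c hc hci.le
    left
    push_cast at hci
    linarith
  · obtain rfl := exponent c hc (by linarith [h.pos p])
    push_cast at hci
    by_cases hpj : p = j
    · subst hpj
      exact Or.inr (Or.inl (by linarith))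
    by_cases hpl : p = l
    · subst hpl
      exact Or.inr (Or.inr (by linarith))
    linarith [large p hpj hpl]

/-- The variables of weight `(1 - ε) / 2` are at most as many as those of weight `ε`. -/
lemma card_half_complement_le (h : IsReducedWeights q) {ε : ℚ} (h0 : 0 < ε) (h1 : ε < 1 / 20) :
    #{i | q i = (1 - ε) / 2} ≤ #{i | q i = ε} := by
  rcases Finset.eq_empty_or_nonempty ({i | q i = (1 - ε) / 2} : Finset (Fin 6)) with he | hne
  · simp [he]
  have factor : ∀ c : Fin 6 → ℕ, ∑ i ∈ ({i | q i = (1 - ε) / 2} : Finset (Fin 6)), (c i : ℚ) * q i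
      = ((∑ i ∈ ({i | q i = (1 - ε) / 2} : Finset (Fin 6)), c i : ℕ) : ℚ) * ((1 - ε) / 2) := by
    intro c
    push_cast
    rw [sum_mul]
    refine sum_congr rfl fun i hi => ?_
    rw [(mem_filter.1 hi).2]
  have two : ∀ (k : ℕ) (x : ℚ), 0 ≤ x → x ≤ 1 / 2 → 1 = x + (k : ℚ) * ((1 - ε) / 2) → x = ε := by
    intro k x hx hx' hk
    rcases Nat.lt_trichotomy k 2 with hlt | rfl | hgt
    · have : (k : ℚ) ≤ 1 := by exact_mod_cast Nat.lt_succ_iff.mp hlt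
      nlinarith
    · push_cast at hk
      linarith
    · have : (3 : ℚ) ≤ k := by exact_mod_cast hgt
      nlinarith
  rcases h.quasiSmooth _ hne with ⟨c, hc⟩ | ⟨J, hJ, -, hc⟩
  · rw [factor] at hc
    have := two _ 0 le_rfl (by norm_num) (by rw [zero_add]; exact hc)
    linarith
  · refine hJ.trans (card_le_card fun m hm => ?_)
    obtain ⟨c, hc⟩ := hc m hm
    rw [factor] at hc
    simpa using two _ _ (h.pos m).le (h.le_half m) hc

lemma not_two_small (h : IsReducedWeights q) {j l : Fin 6} (hjl : j ≠ l)
    (hj : q j < 1 / 20) (hl : q l < 1 / 20) : False := by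
  have hj0 := h.pos j
  have hl0 := h.pos l
  have mono : ∀ i ∈ ({j, l} : Finset (Fin 6))ᶜ, 2 / 5 < q i ∧
      (q i = 1 / 2 ∨ q i = (1 - q j) / 2 ∨ q i = (1 - q l) / 2) := by
    intro i hi
    simp only [mem_compl, mem_insert, mem_singleton, not_or] at hi
    exact h.monomial_of_two_small hjl hj hl hi.1 hi.2
  have total : ∑ i ∈ ({j, l} : Finset (Fin 6))ᶜ, (1 / 2 - q i) = q j + q l := by
    have hs := h.sum_eq
    rw [← sum_add_sum_compl ({j, l} : Finset (Fin 6)), sum_pair hjl] at hs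
    rw [sum_sub_distrib, sum_const, card_compl, card_pair hjl, Fintype.card_fin, nsmul_eq_mul]
    push_cast
    linarith
  have small : ∀ i, q i < 1 / 20 → i = j ∨ i = l := by
    intro i hi
    by_contra hne
    have := (mono i (by simpa using hne)).1
    linarith
  have indicator : ∀ (ε : ℚ), 0 < ε → ε < 1 / 20 →
      ∑ i ∈ ({j, l} : Finset (Fin 6))ᶜ, (if q i = (1 - ε) / 2 then ε / 2 else 0)
        ≤ (#{i | q i = ε} : ℚ) * (ε / 2) := by
    intro ε h0 h1
    calc _ ≤ ∑ i, (if q i = (1 - ε) / 2 then ε / 2 else 0) :=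
          sum_le_sum_of_subset_of_nonneg (subset_univ _) fun i _ _ => by
            split_ifs <;> linarith
      _ = (#{i | q i = (1 - ε) / 2} : ℚ) * (ε / 2) := by
          rw [← sum_filter, sum_const, nsmul_eq_mul]
      _ ≤ _ := by
          have : (#{i | q i = (1 - ε) / 2} : ℚ) ≤ #{i | q i = ε} := by
            exact_mod_cast h.card_half_complement_le h0 h1
          gcongr
  by_cases heq : q j = q l
  · have hcard : (#{i | q i = q j} : ℚ) ≤ 2 := by
      have : #{i | q i = q j} ≤ #({j, l} : Finset (Fin 6)) := card_le_card fun i hi => by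
        have := small i (by rw [(mem_filter.1 hi).2]; exact hj)
        simpa using this
      rw [card_pair hjl] at this
      exact_mod_cast this
    have hle : q j + q l ≤ (#{i | q i = q j} : ℚ) * (q j / 2) := by
      rw [← total]
      refine le_trans (sum_le_sum fun i hi => ?_) (indicator _ hj0 hj)
      obtain ⟨-, hi | hi | hi⟩ := mono i hi <;> split_ifs <;> first | linarith | skip
      · rw [heq] at *; contradiction
    nlinarith
  · have hone : ∀ k m : Fin 6, q m ≠ q k → (∀ i, q i < 1 / 20 → i = k ∨ i = m) →
        q k < 1 / 20 → (#{i | q i = q k} : ℚ) ≤ 1 := by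
      intro k m hne hs hk
      have : #{i | q i = q k} ≤ #({k} : Finset (Fin 6)) := card_le_card fun i hi => by
        have hi' := (mem_filter.1 hi).2
        rcases hs i (by rw [hi']; exact hk) with rfl | rfl
        · simp
        · exact absurd hi' hne
      rw [card_singleton] at this
      exact_mod_cast this
    have hcj := hone j l (Ne.symm heq) small hj
    have hcl := hone l j heq (fun i hi => (small i hi).symm) hl
    have hle : q j + q l ≤
        (#{i | q i = q j} : ℚ) * (q j / 2) + (#{i | q i = q l} : ℚ) * (q l / 2) := by
      rw [← total]
      refine le_trans ?_ (add_le_add (indicator _ hj0 hj) (indicator _ hl0 hl))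
      rw [← sum_add_distrib]
      refine sum_le_sum fun i hi => ?_
      obtain ⟨-, hi | hi | hi⟩ := mono i hi <;> split_ifs <;> linarith
    nlinarith

end IsReducedWeights

/-- The monomials of degree `1` with exponents below `21`. -/
def boundedMonomials (q : Fin 6 → ℚ) : Set (Fin 6 → Fin 21) :=
  {v | ∑ i, ((v i : ℕ) : ℚ) * q i = 1}

lemma sum_mul_eq_one_of_boundedMonomials_eq {q q' : Fin 6 → ℚ}
    (h : boundedMonomials q = boundedMonomials q') {v : Fin 6 → ℕ} (hv : ∀ i, v i < 21)
    (hq : ∑ i, (v i : ℚ) * q i = 1) : ∑ i, (v i : ℚ) * (q i - q' i) = 0 := by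
  have hmem : (fun i => (⟨v i, hv i⟩ : Fin 21)) ∈ boundedMonomials q := hq
  rw [h] at hmem
  have hq' : ∑ i, (v i : ℚ) * q' i = 1 := hmem
  simp only [mul_sub, sum_sub_distrib, hq, hq', sub_self]

lemma exponent_lt_of_mul_le_one {c : ℕ} {x : ℚ} (hx : 1 / 20 ≤ x) (hc : (c : ℚ) * x ≤ 1) :
    c < 21 := by
  by_contra! hlt
  have : (21 : ℚ) ≤ c := by exact_mod_cast hlt
  nlinarith

namespace IsReducedWeights

variable {q q' : Fin 6 → ℚ}

lemma difference_monomial (h : IsReducedWeights q)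
    (hR : boundedMonomials q = boundedMonomials q') {i : Fin 6} (hi : 1 / 20 ≤ q i) :
    q i - q' i = 0 ∨
    (∃ p, p ≠ i ∧ ∃ c : ℕ, 2 ≤ c ∧ q p + (c : ℚ) * q i = 1 ∧
      (q p - q' p) + (c : ℚ) * (q i - q' i) = 0) := by
  rcases h.exists_monomial i with ⟨c, hc, hci⟩ | ⟨p, hpi, c, hc, hci⟩
  · left
    have := sum_mul_eq_one_of_boundedMonomials_eq hR (v := Pi.single i c)
      (fun k => by
        rcases eq_or_ne k i with rfl | hk
        · simpa using exponent_lt_of_mul_le_one hi hci.le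
        · simp [hk])
      (by simpa [Pi.single_apply] using hci)
    have hc0 : (c : ℚ) ≠ 0 := by positivity
    simpa [Pi.single_apply, hc0] using this
  · right
    refine ⟨p, hpi, c, hc, hci, ?_⟩
    have hlt := exponent_lt_of_mul_le_one hi (by linarith [h.pos p] : (c : ℚ) * q i ≤ 1)
    have := sum_mul_eq_one_of_boundedMonomials_eq hR
      (v := fun k => if k = p then 1 else if k = i then c else 0)
      (fun k => by split_ifs <;> omega)
      (by
        rw [← hci, ← sum_subset (subset_univ {p, i}) (by intro k _ hk; simp at hk; simp [hk]),
          sum_pair hpi]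
        simp [hpi.symm])
    rw [← sum_subset (subset_univ {p, i}) (by intro k _ hk; simp at hk; simp [hk]),
      sum_pair hpi] at this
    simpa [hpi.symm] using this

lemma abs_difference_le (h : IsReducedWeights q)
    (hR : boundedMonomials q = boundedMonomials q') {j : Fin 6}
    (hlarge : ∀ i, i ≠ j → 1 / 20 ≤ q i) {i : Fin 6} (hij : i ≠ j) :
    |q i - q' i| ≤ |q j - q' j| / 2 := by
  have hmax := exists_max_image ({j}ᶜ : Finset (Fin 6)) (fun k => |q k - q' k|) ⟨i, by simpa⟩
  obtain ⟨k, hk, hkmax⟩ := hmax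
  have hkj : k ≠ j := by simpa using hk
  refine (hkmax i (by simpa)).trans ?_
  rcases h.difference_monomial hR (hlarge k hkj) with h0 | ⟨p, -, c, hc, -, he⟩
  · rw [h0, abs_zero]
    positivity
  · have hc' : (2 : ℚ) ≤ c := by exact_mod_cast hc
    have habs : |q p - q' p| = c * |q k - q' k| := by
      rw [eq_neg_of_add_eq_zero_left he, abs_neg, abs_mul, Nat.abs_cast]
    have hk0 := abs_nonneg (q k - q' k)
    by_cases hpj : p = j
    · subst hpj
      nlinarith
    · have := hkmax p (by simpa)
      have := abs_nonneg (q j - q' j)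
      nlinarith

lemma difference_le_quarter (h : IsReducedWeights q)
    (hR : boundedMonomials q = boundedMonomials q') {j : Fin 6}
    (hlarge : ∀ i, i ≠ j → 1 / 20 ≤ q i) (hj : 0 ≤ q j - q' j) {i : Fin 6} (hij : i ≠ j) :
    q i - q' i ≤ (q j - q' j) / 4 := by
  rcases h.difference_monomial hR (hlarge i hij) with h0 | ⟨p, -, c, hc, -, he⟩
  · linarith
  · have hc' : (2 : ℚ) ≤ c := by exact_mod_cast hc
    by_cases hpj : p = j
    · subst hpj
      nlinarith
    · have hp := h.abs_difference_le hR hlarge hpj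
      rw [abs_of_nonneg hj] at hp
      have := (abs_le.1 hp).1
      nlinarith

/-- The variables `x_i` in monomials `x_j * x_i ^ c`. -/
def attached (q : Fin 6 → ℚ) (j : Fin 6) : Set (Fin 6) :=
  {i | i ≠ j ∧ ∃ c : ℕ, 2 ≤ c ∧ q j + (c : ℚ) * q i = 1}

lemma difference_of_attached (h : IsReducedWeights q)
    (hR : boundedMonomials q = boundedMonomials q') {j : Fin 6}
    (hlarge : ∀ i, i ≠ j → 1 / 20 ≤ q i) {i : Fin 6} (hi : i ∈ attached q j) :
    q i * (q j - q' j) = -(1 - q j) * (q i - q' i) := by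
  obtain ⟨hij, c, hc, hci⟩ := hi
  have hlt := exponent_lt_of_mul_le_one (hlarge i hij)
    (by linarith [h.pos j] : (c : ℚ) * q i ≤ 1)
  have := sum_mul_eq_one_of_boundedMonomials_eq hR
    (v := fun k => if k = j then 1 else if k = i then c else 0)
    (fun k => by split_ifs <;> omega)
    (by
      rw [← hci, ← sum_subset (subset_univ {j, i}) (by intro k _ hk; simp at hk; simp [hk]),
        sum_pair hij.symm]
      simp [hij])
  rw [← sum_subset (subset_univ {j, i}) (by intro k _ hk; simp at hk; simp [hk]),
    sum_pair hij.symm] at this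
  simp [hij] at this
  linear_combination q i * this - (q i - q' i) * hci

open Classical in
lemma card_attached_le_one (h : IsReducedWeights q)
    (hR : boundedMonomials q = boundedMonomials q') {j : Fin 6}
    (hlarge : ∀ i, i ≠ j → 1 / 20 ≤ q i) (hj : 0 < q j - q' j) :
    #{i | i ∈ attached q j} ≤ 1 := by
  set D : Finset (Fin 6) := {i | i ∈ attached q j} with hD
  have mem_D : ∀ i, i ∈ D ↔ i ∈ attached q j := by simp [hD]
  rcases D.eq_empty_or_nonempty with he | hne
  · simp [he]
  have hqj := h.pos j
  have hqj' := h.le_half j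
  have scaled : ∀ k : Fin 6 → ℕ, (∑ i ∈ D, (k i : ℚ) * q i) * (q j - q' j)
      = -(1 - q j) * ∑ i ∈ D, (k i : ℚ) * (q i - q' i) := by
    intro k
    rw [sum_mul, mul_sum]
    refine sum_congr rfl fun i hi => ?_
    linear_combination (k i : ℚ) * h.difference_of_attached hR hlarge ((mem_D i).1 hi)
  have bound : ∀ k : Fin 6 → ℕ, ∑ i ∈ D, (k i : ℚ) * q i ≤ 1 → ∀ i ∈ D, k i < 21 := by
    intro k hk i hi
    refine exponent_lt_of_mul_le_one (hlarge i ((mem_D i).1 hi).1) (le_trans ?_ hk)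
    exact single_le_sum (f := fun i => (k i : ℚ) * q i)
      (fun l _ => mul_nonneg (by positivity) (h.pos l).le) hi
  have extend : ∀ (k : Fin 6 → ℕ) (e : Fin 6 → ℚ),
      ∑ i, ((if i ∈ D then k i else 0 : ℕ) : ℚ) * e i = ∑ i ∈ D, (k i : ℚ) * e i := by
    intro k e
    simp [ite_mul]
  rcases h.quasiSmooth D hne with ⟨k, hk⟩ | ⟨J, hJ, hdisj, hJk⟩
  · have h0 := sum_mul_eq_one_of_boundedMonomials_eq hR (v := fun i => if i ∈ D then k i else 0)
      (fun i => by
        split_ifs with hi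
        · exact bound k hk.ge i hi
        · omega)
      (by rw [extend, ← hk])
    rw [extend] at h0
    have := scaled k
    rw [h0, ← hk] at this
    linarith
  · refine hJ.trans (card_le_one.2 fun a ha b hb => ?_)
    suffices key : ∀ m ∈ J, m = j by rw [key a ha, key b hb]
    intro m hm
    by_contra hmj
    obtain ⟨k, hk⟩ := hJk m hm
    have hmD : m ∉ D := disjoint_left.1 hdisj hm
    have extend' : ∀ e : Fin 6 → ℚ,
        ∑ i, ((if i = m then 1 else if i ∈ D then k i else 0 : ℕ) : ℚ) * e i
          = e m + ∑ i ∈ D, (k i : ℚ) * e i := by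
      intro e
      rw [← extend, Fintype.sum_eq_add_sum_compl m, Fintype.sum_eq_add_sum_compl m
        (fun i => ((if i ∈ D then k i else 0 : ℕ) : ℚ) * e i)]
      have : ∑ i ∈ {m}ᶜ, ((if i = m then 1 else if i ∈ D then k i else 0 : ℕ) : ℚ) * e i
          = ∑ i ∈ {m}ᶜ, ((if i ∈ D then k i else 0 : ℕ) : ℚ) * e i :=
        sum_congr rfl fun i hi => by rw [if_neg (by simpa using hi)]
      rw [this]
      simp [hmD]
    have h0 := sum_mul_eq_one_of_boundedMonomials_eq hR
      (v := fun i => if i = m then 1 else if i ∈ D then k i else 0)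
      (fun i => by
        split_ifs with h1 hi
        · omega
        · exact bound k (by linarith [h.pos m]) i hi
        · omega)
      (by rw [extend', ← hk])
    rw [extend'] at h0
    have hsc := scaled k
    have hquarter := h.difference_le_quarter hR hlarge hj.le hmj
    have hm2 := h.le_half m
    rw [show ∑ i ∈ D, (k i : ℚ) * q i = 1 - q m by linarith,
      show ∑ i ∈ D, (k i : ℚ) * (q i - q' i) = -(q m - q' m) by linarith] at hsc
    nlinarith

lemma not_difference_pos (h : IsReducedWeights q) (h' : IsReducedWeights q')
    (hR : boundedMonomials q = boundedMonomials q') {j : Fin 6}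
    (hlarge : ∀ i, i ≠ j → 1 / 20 ≤ q i) (hj : 0 < q j - q' j) : False := by
  classical
  set t := q j - q' j with ht
  have hcard := h.card_attached_le_one hR hlarge hj
  have total : ∑ i ∈ {j}ᶜ, (q i - q' i) = -t := by
    have : ∑ i, (q i - q' i) = 0 := by rw [sum_sub_distrib, h.sum_eq, h'.sum_eq, sub_self]
    rw [Fintype.sum_eq_add_sum_compl j] at this
    linarith
  have indicator : ∀ s : ℚ, 0 ≤ s →
      ∑ i ∈ ({j}ᶜ : Finset (Fin 6)), (if i ∈ attached q j then s else 0) ≤ s := by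
    intro s hs
    calc _ ≤ ∑ i, (if i ∈ attached q j then s else 0) :=
          sum_le_sum_of_subset_of_nonneg (subset_univ _) fun i _ _ => by split_ifs <;> linarith
      _ = (#{i | i ∈ attached q j} : ℚ) * s := by
          rw [← sum_filter, sum_const, nsmul_eq_mul]
      _ ≤ 1 * s := by
          gcongr
          exact_mod_cast hcard
      _ = s := one_mul s
  have half : ∀ i, i ≠ j → -(t / 2) ≤ q i - q' i := by
    intro i hi
    have := h.abs_difference_le hR hlarge hi
    rw [abs_of_pos hj] at this
    exact (abs_le.1 this).1
  have attached_neg : ∀ i ∈ attached q j, q i - q' i < 0 := by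
    intro i hi
    have := h.difference_of_attached hR hlarge hi
    have := mul_pos (h.pos i) hj
    have := h.le_half j
    nlinarith
  have unattached : ∀ i, i ≠ j → i ∉ attached q j → q i - q' i = 0 ∨
      ∃ p, p ≠ j ∧ ∃ c : ℕ, 2 ≤ c ∧ (q p - q' p) + (c : ℚ) * (q i - q' i) = 0 := by
    intro i hi hia
    refine (h.difference_monomial hR (hlarge i hi)).imp_right ?_
    rintro ⟨p, -, c, hc, hci, he⟩
    refine ⟨p, ?_, c, hc, he⟩
    rintro rfl
    exact hia ⟨hi, c, hc, hci⟩
  by_cases hpos : ∃ k, k ≠ j ∧ 0 < q k - q' k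
  · obtain ⟨k, hkj, hk⟩ := hpos
    have lower : ∀ i, i ≠ j →
        -(t / 8) - (if i ∈ attached q j then 3 * t / 8 else 0) ≤ q i - q' i := by
      intro i hi
      split_ifs with hia
      · linarith [half i hi]
      · rcases unattached i hi hia with h0 | ⟨p, hp, c, hc, he⟩
        · linarith
        · have hc' : (2 : ℚ) ≤ c := by exact_mod_cast hc
          have := h.difference_le_quarter hR hlarge hj.le hp
          nlinarith
    have hlt := sum_lt_sum (s := ({j}ᶜ : Finset (Fin 6)))
      (fun i hi => lower i (by simpa using hi)) ⟨k, by simpa, by split_ifs <;> linarith⟩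
    rw [total, sum_sub_distrib, sum_const, card_compl, card_singleton, Fintype.card_fin,
      nsmul_eq_mul] at hlt
    push_cast at hlt
    linarith [indicator (3 * t / 8) (by linarith)]
  · push Not at hpos
    have lower : ∀ i ∈ ({j}ᶜ : Finset (Fin 6)),
        -(if i ∈ attached q j then t / 2 else 0) ≤ q i - q' i := by
      intro i hi
      have hi : i ≠ j := by simpa using hi
      split_ifs with hia
      · exact half i hi
      · rcases unattached i hi hia with h0 | ⟨p, hp, c, hc, he⟩
        · linarith
        · have hc' : (2 : ℚ) ≤ c := by exact_mod_cast hc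
          have := hpos p hp
          nlinarith
    have hle := sum_le_sum lower
    rw [total, sum_neg_distrib] at hle
    linarith [indicator (t / 2) (by linarith)]

lemma eq_of_boundedMonomials_eq (h : IsReducedWeights q) (h' : IsReducedWeights q')
    (hR : boundedMonomials q = boundedMonomials q') {j : Fin 6}
    (hlarge : ∀ i, i ≠ j → 1 / 20 ≤ q i) (hlarge' : ∀ i, i ≠ j → 1 / 20 ≤ q' i) :
    q = q' := by
  have hj : q j - q' j = 0 := by
    rcases lt_trichotomy (q j - q' j) 0 with hlt | heq | hgt
    · exact (h'.not_difference_pos h hR.symm hlarge' (by linarith)).elim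
    · exact heq
    · exact (h.not_difference_pos h' hR hlarge hgt).elim
  funext i
  rcases eq_or_ne i j with rfl | hij
  · linarith
  · have := h.abs_difference_le hR hlarge hij
    rw [hj, abs_zero, zero_div, abs_nonpos_iff] at this
    linarith

end IsReducedWeights

/-- There are finitely many reduced quasi-smooth weights. -/
theorem finite_isReducedWeights : {q | IsReducedWeights q}.Finite := by
  have cover : {q | IsReducedWeights q} ⊆
      ⋃ j : Fin 6, {q | IsReducedWeights q ∧ ∀ i, i ≠ j → 1 / 20 ≤ q i} := by
    intro q (h : IsReducedWeights q)
    rw [Set.mem_iUnion]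
    by_cases hs : ∃ j, q j < 1 / 20
    · obtain ⟨j, hj⟩ := hs
      refine ⟨j, h, fun i hi => ?_⟩
      by_contra! hlt
      exact h.not_two_small hi hlt hj
    · push Not at hs
      exact ⟨0, h, fun i _ => hs i⟩
  refine (Set.finite_iUnion fun j => ?_).subset cover
  refine Set.Finite.of_finite_image (f := boundedMonomials) (Set.toFinite _) ?_
  rintro q ⟨h, hl⟩ q' ⟨h', hl'⟩ hR
  exact h.eq_of_boundedMonomials_eq h' hR hl hl'

namespace QuasiSmoothCrit

variable {a : Fin 6 → ℕ} {d : ℕ}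

lemma isReducedWeights (h : QuasiSmoothCrit a d) (hd : 0 < d) (ha : ∀ i, 0 < a i)
    (hsum : ∑ i, a i = 2 * d) (hle : ∀ i, 2 * a i ≤ d) :
    IsReducedWeights fun i => (a i : ℚ) / d := by
  have hd' : (0 : ℚ) < d := by exact_mod_cast hd
  have scale : ∀ (I : Finset (Fin 6)) (c : Fin 6 → ℕ),
      ∑ i ∈ I, (c i : ℚ) * ((a i : ℚ) / d) = ((∑ i ∈ I, c i * a i : ℕ) : ℚ) / d := by
    intro I c
    push_cast
    rw [sum_div]
    exact sum_congr rfl fun i _ => by ring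
  refine ⟨fun i => ?_, fun i => ?_, ?_, fun I hI => ?_⟩
  · have : (0 : ℚ) < a i := by exact_mod_cast ha i
    positivity
  · have : (2 : ℚ) * a i ≤ d := by exact_mod_cast hle i
    rw [div_le_iff₀ hd']
    linarith
  · rw [← sum_div, ← Nat.cast_sum, hsum]
    push_cast
    field_simp
  · refine (h I hI).imp ?_ ?_
    · rintro ⟨c, hc⟩
      exact ⟨c, by rw [scale, ← hc, div_self hd'.ne']⟩
    · rintro ⟨J, hJ, hdisj, hc⟩
      refine ⟨J, hJ, hdisj, fun j hj => ?_⟩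
      obtain ⟨c, hc⟩ := hc j hj
      refine ⟨c, ?_⟩
      rw [scale, ← add_div, eq_div_iff hd'.ne', one_mul]
      exact_mod_cast hc

/-- A weight exceeding `d / 2` is complementary to another weight. -/
lemma exists_add_eq (h : QuasiSmoothCrit a d) (hlt : ∀ i, a i < d) {i : Fin 6}
    (hi : d < 2 * a i) : ∃ m, m ≠ i ∧ a m + a i = d := by
  have one : ∀ c x : ℕ, x < d → d = x + c * a i → x + a i = d := by
    intro c x hx hc
    rcases Nat.lt_trichotomy c 1 with h0 | rfl | h2
    · obtain rfl : c = 0 := by omega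
      omega
    · omega
    · nlinarith
  rcases h {i} (by simp) with ⟨c, hc⟩ | ⟨J, hJ, hdisj, hc⟩
  · rw [sum_singleton] at hc
    have := one (c i) 0 (by linarith [hlt i]) (by omega)
    have := hlt i
    omega
  · obtain ⟨m, hm⟩ : J.Nonempty := by
      rw [← card_pos]
      simpa using hJ
    obtain ⟨c, hc⟩ := hc m hm
    rw [sum_singleton] at hc
    refine ⟨m, ?_, one (c i) _ (hlt m) hc⟩
    rintro rfl
    simp [hm] at hdisj

lemma sum_four_lt (ha : ∀ i, 0 < a i) {s : Finset (Fin 6)} (hs : #s ≤ 4) :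
    ∑ i ∈ s, a i < ∑ i, a i := by
  obtain ⟨k, hk⟩ : ∃ k, k ∉ s := by
    by_contra! hall
    rw [eq_univ_iff_forall.2 hall] at hs
    simp at hs
  exact sum_lt_sum_of_subset (subset_univ s) (mem_univ k) hk (ha k) fun _ _ _ => Nat.zero_le _

lemma add_add_add_lt (ha : ∀ i, 0 < a i) {i j k l : Fin 6} (hij : i ≠ j) (hik : i ≠ k)
    (hil : i ≠ l) (hjk : j ≠ k) (hjl : j ≠ l) (hkl : k ≠ l) :
    a i + a j + a k + a l < ∑ i, a i := by
  have := sum_four_lt ha (s := {i, j, k, l}) card_le_four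
  rw [sum_insert (by simp [*]), sum_insert (by simp [*]), sum_pair hkl] at this
  omega

/-- Two complementary weights of which one exceeds `d / 2` leave only weights at most `d / 2`. -/
lemma two_mul_le_of_complementary (h : QuasiSmoothCrit a d) (ha : ∀ i, 0 < a i)
    (hlt : ∀ i, a i < d) (hsum : ∑ i, a i = 2 * d) {x m : Fin 6} (hx : d < 2 * a x)
    (hmx : m ≠ x) (hm : a m + a x = d) {i : Fin 6} (hix : i ≠ x) (him : i ≠ m) :
    2 * a i ≤ d := by
  by_contra! hi
  obtain ⟨l, hli, hl⟩ := h.exists_add_eq hlt hi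
  by_cases hlx : l = x
  · subst hlx
    omega
  by_cases hlm : l = m
  swap
  · have := add_add_add_lt ha hmx (Ne.symm hlm) him.symm (Ne.symm hlx) hix.symm hli
    omega
  subst hlm
  have hix' : a i = a x := by omega
  have one : ∀ c y : ℕ, y < d → d = y + c * a x → y = a l := by
    intro c y hy hc
    rcases Nat.lt_trichotomy c 1 with h0 | rfl | h2
    · obtain rfl : c = 0 := by omega
      omega
    · omega
    · nlinarith
  have factor : ∀ c : Fin 6 → ℕ, ∑ k ∈ {x, i}, c k * a k = (c x + c i) * a x := by
    intro c
    rw [sum_pair hix.symm, hix']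
    ring
  rcases h {x, i} (by simp) with ⟨c, hc⟩ | ⟨J, hJ, hdisj, hc⟩
  · rw [factor] at hc
    have := one _ 0 (by linarith [hlt x]) (by rw [zero_add]; exact hc)
    have := ha l
    omega
  · rw [card_pair hix.symm] at hJ
    obtain ⟨k, hkJ, hkl⟩ := exists_mem_ne (by omega : 1 < #J) l
    obtain ⟨c, hc⟩ := hc k hkJ
    rw [factor] at hc
    have hk := one _ _ (hlt k) hc
    have hkI := disjoint_left.1 hdisj hkJ
    simp only [mem_insert, mem_singleton, not_or] at hkI
    have := add_add_add_lt ha hmx him.symm (Ne.symm hkl) hix.symm (Ne.symm hkI.1) (Ne.symm hkI.2)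
    omega

lemma restrict_of_mem (h : QuasiSmoothCrit a d) {x : Fin 6} (y : Fin 6)
    {I : Finset (Fin 6)} (hxI : x ∉ I)
    (hx : ∃ c : Fin 6 → ℕ, a x = ∑ i ∈ I, c i * a i) :
    (∃ c : Fin 6 → ℕ, d = ∑ i ∈ I, c i * a i) ∨
    (∃ J : Finset (Fin 6), I.card ≤ J.card ∧ Disjoint J I ∧ x ∉ J ∧ y ∉ J ∧
      ∀ j ∈ J, ∃ c : Fin 6 → ℕ, d = a j + ∑ i ∈ I, c i * a i) := by
  obtain ⟨b, hb⟩ := hx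
  have absorb : ∀ c : Fin 6 → ℕ, ∃ c' : Fin 6 → ℕ,
      ∑ i ∈ insert x I, c i * a i = ∑ i ∈ I, c' i * a i := by
    intro c
    refine ⟨fun i => c x * b i + c i, ?_⟩
    rw [sum_insert hxI, hb, mul_sum, ← sum_add_distrib]
    exact sum_congr rfl fun i _ => by ring
  rcases h (insert x I) (insert_nonempty _ _) with ⟨c, hc⟩ | ⟨J, hJ, hdisj, hc⟩
  · obtain ⟨c', hc'⟩ := absorb c
    exact Or.inl ⟨c', hc.trans hc'⟩
  · rw [card_insert_of_notMem hxI] at hJ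
    rw [disjoint_insert_right] at hdisj
    refine Or.inr ⟨J.erase y, ?_, hdisj.2.mono_left (erase_subset _ _), ?_, by simp, ?_⟩
    · have := pred_card_le_card_erase (s := J) (a := y)
      omega
    · exact fun hx => hdisj.1 (mem_of_mem_erase hx)
    · intro j hj
      obtain ⟨c, hc⟩ := hc j (mem_of_mem_erase hj)
      obtain ⟨c', hc'⟩ := absorb c
      exact ⟨c', by rw [← hc']; exact hc⟩

/-- The criterion passes to the complement of two complementary weights. -/
lemma restrict (h : QuasiSmoothCrit a d) {x y : Fin 6}
    (hd : a x + a y = d) {I : Finset (Fin 6)} (hI : I.Nonempty) (hxI : x ∉ I) (hyI : y ∉ I) :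
    (∃ c : Fin 6 → ℕ, d = ∑ i ∈ I, c i * a i) ∨
    (∃ J : Finset (Fin 6), I.card ≤ J.card ∧ Disjoint J I ∧ x ∉ J ∧ y ∉ J ∧
      ∀ j ∈ J, ∃ c : Fin 6 → ℕ, d = a j + ∑ i ∈ I, c i * a i) := by
  by_cases hx : ∃ c : Fin 6 → ℕ, a x = ∑ i ∈ I, c i * a i
  · exact h.restrict_of_mem y hxI hx
  by_cases hy : ∃ c : Fin 6 → ℕ, a y = ∑ i ∈ I, c i * a i
  · refine (h.restrict_of_mem x hyI hy).imp_right ?_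
    rintro ⟨J, hJ, hdisj, hyJ, hxJ, hc⟩
    exact ⟨J, hJ, hdisj, hxJ, hyJ, hc⟩
  refine (h I hI).imp_right ?_
  rintro ⟨J, hJ, hdisj, hc⟩
  refine ⟨J, hJ, hdisj, fun hxJ => hy ?_, fun hyJ => hx ?_, hc⟩
  · obtain ⟨c, hc⟩ := hc x hxJ
    exact ⟨c, by omega⟩
  · obtain ⟨c, hc⟩ := hc y hyJ
    exact ⟨c, by omega⟩

/-- Replacing two complementary weights by `d / 2` preserves quasi-smoothness. -/
lemma isReducedWeights_of_complementary (h : QuasiSmoothCrit a d) (hd : 0 < d)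
    (ha : ∀ i, 0 < a i) (hsum : ∑ i, a i = 2 * d) {x y : Fin 6} (hxy : x ≠ y)
    (hadd : a x + a y = d) (hle : ∀ i, i ≠ x → i ≠ y → 2 * a i ≤ d) :
    IsReducedWeights fun i => if i = x ∨ i = y then 1 / 2 else (a i : ℚ) / d := by
  have hd' : (0 : ℚ) < d := by exact_mod_cast hd
  have scale : ∀ (I : Finset (Fin 6)) (c : Fin 6 → ℕ), x ∉ I → y ∉ I →
      ∑ i ∈ I, (c i : ℚ) * (if i = x ∨ i = y then 1 / 2 else (a i : ℚ) / d)
        = ((∑ i ∈ I, c i * a i : ℕ) : ℚ) / d := by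
    intro I c hx hy
    push_cast
    rw [sum_div]
    refine sum_congr rfl fun i hi => ?_
    rw [if_neg]
    · ring
    · rintro (rfl | rfl) <;> contradiction
  refine ⟨fun i => ?_, fun i => ?_, ?_, fun I hI => ?_⟩
  · have : (0 : ℚ) < a i := by exact_mod_cast ha i
    split_ifs <;> positivity
  · split_ifs with hi
    · exact le_rfl
    · rw [not_or] at hi
      have : (2 : ℚ) * a i ≤ d := by exact_mod_cast hle i hi.1 hi.2
      rw [div_le_iff₀ hd']
      linarith
  · have hrest := scale ({x, y}ᶜ) (fun _ => 1) (by simp) (by simp)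
    simp only [Nat.cast_one, one_mul] at hrest
    have hs : ∑ i ∈ ({x, y} : Finset (Fin 6))ᶜ, a i = d := by
      rw [← sum_add_sum_compl ({x, y} : Finset (Fin 6)), sum_pair hxy] at hsum
      omega
    rw [← sum_add_sum_compl ({x, y} : Finset (Fin 6)), hrest, hs, sum_pair hxy,
      div_self hd'.ne']
    norm_num
  · have half : ∀ z, (z = x ∨ z = y) → z ∈ I → ∃ c : Fin 6 → ℕ, (1 : ℚ) =
        ∑ i ∈ I, (c i : ℚ) * (if i = x ∨ i = y then 1 / 2 else (a i : ℚ) / d) := by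
      intro z hz hzI
      refine ⟨Pi.single z 2, ?_⟩
      rw [sum_eq_single z (fun i _ hi => by simp [hi]) (fun hn => absurd hzI hn), if_pos hz]
      simp
    by_cases hxI : x ∈ I
    · exact Or.inl (half x (Or.inl rfl) hxI)
    by_cases hyI : y ∈ I
    · exact Or.inl (half y (Or.inr rfl) hyI)
    refine (h.restrict hadd hI hxI hyI).imp ?_ ?_
    · rintro ⟨c, hc⟩
      exact ⟨c, by rw [scale I c hxI hyI, ← hc, div_self hd'.ne']⟩
    · rintro ⟨J, hJ, hdisj, hxJ, hyJ, hc⟩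
      refine ⟨J, hJ, hdisj, fun j hj => ?_⟩
      obtain ⟨c, hc⟩ := hc j hj
      refine ⟨c, ?_⟩
      rw [scale I c hxI hyI, if_neg (by rintro (rfl | rfl) <;> contradiction), ← add_div,
        eq_div_iff hd'.ne', one_mul]
      exact_mod_cast hc

end QuasiSmoothCrit

/-- The weights other than those of index `x` and `y` have no common factor. -/
def CoprimeOutside (a : Fin 6 → ℕ) (x y : Fin 6) : Prop :=
  ∀ n t : ℕ, (∀ i, i ≠ x → i ≠ y → n ∣ a i * t) → n ∣ t

lemma coprimeOutside_of_gcd {a : Fin 6 → ℕ}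
    (h : ∀ i j k l : Fin 6, i < j → j < k → k < l →
      Nat.gcd (a i) (Nat.gcd (a j) (Nat.gcd (a k) (a l))) = 1) (x y : Fin 6) :
    CoprimeOutside a x y := by
  intro n t hn
  obtain ⟨i, j, k, l, hij, hjk, hkl, hi, hj, hk, hl⟩ : ∃ i j k l : Fin 6, i < j ∧ j < k ∧ k < l ∧
      (i ≠ x ∧ i ≠ y) ∧ (j ≠ x ∧ j ≠ y) ∧ (k ≠ x ∧ k ≠ y) ∧ (l ≠ x ∧ l ≠ y) := by
    clear hn
    revert x y
    decide
  have hdvd := Nat.dvd_gcd (hn i hi.1 hi.2) (Nat.dvd_gcd (hn j hj.1 hj.2)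
    (Nat.dvd_gcd (hn k hk.1 hk.2) (hn l hl.1 hl.2)))
  simpa only [Nat.gcd_mul_right, h i j k l hij hjk hkl, one_mul] using hdvd

/-- The degrees of coprime weights with given ratios outside the indices `x` and `y`. -/
def degreesOf (q : Fin 6 → ℚ) (x y : Fin 6) : Set ℕ :=
  {d | 0 < d ∧ ∃ a : Fin 6 → ℕ, CoprimeOutside a x y ∧
    ∀ i, i ≠ x → i ≠ y → q i = (a i : ℚ) / d}

lemma subsingleton_degreesOf (q : Fin 6 → ℚ) (x y : Fin 6) : (degreesOf q x y).Subsingleton := by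
  have key : ∀ d ∈ degreesOf q x y, ∀ d' ∈ degreesOf q x y, d ∣ d' := by
    rintro d ⟨hd, a, hco, ha⟩ d' ⟨hd', a', -, ha'⟩
    refine hco d d' fun i hix hiy => ⟨a' i, ?_⟩
    have heq := (ha i hix hiy).symm.trans (ha' i hix hiy)
    rw [div_eq_div_iff (by positivity) (by positivity)] at heq
    rw [mul_comm d]
    exact_mod_cast heq
  exact fun d hd d' hd' => Nat.dvd_antisymm (key d hd d' hd') (key d' hd' d hd)

lemma finite_degrees :
    (⋃ q ∈ {q | IsReducedWeights q}, ⋃ x, ⋃ y, degreesOf q x y).Finite :=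
  finite_isReducedWeights.biUnion fun q _ => Set.finite_iUnion fun x => Set.finite_iUnion fun y =>
    (subsingleton_degreesOf q x y).finite

/-- Boundedness: only finitely many tuples of weights and degrees satisfy the
numerical conditions characterizing FK3 weighted fourfold hypersurfaces with
singular locus of dimension at most one. -/
theorem stmt_13 :
    Set.Finite {p : (Fin 6 → ℕ) × ℕ |
      (∀ i, 0 < p.1 i) ∧ 0 < p.2 ∧ Monotone p.1 ∧ p.1 5 < p.2 ∧
      (∑ i, p.1 i) = 2 * p.2 ∧
      (∀ i j k l : Fin 6, i < j → j < k → k < l →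
        Nat.gcd (p.1 i) (Nat.gcd (p.1 j) (Nat.gcd (p.1 k) (p.1 l))) = 1) ∧
      (∀ i j k : Fin 6, i < j → j < k →
        Nat.gcd (p.1 i) (Nat.gcd (p.1 j) (p.1 k)) ∣ p.2) ∧
      QuasiSmoothCrit p.1 p.2} := by
  obtain ⟨N, hN⟩ := finite_degrees.bddAbove
  refine ((Set.Finite.pi' fun _ : Fin 6 => Set.finite_Iic N).prod (Set.finite_Iic N)).subset ?_
  rintro ⟨a, d⟩ ⟨ha, hd, hmono, h5, hsum, hgcd, -, hqs⟩
  dsimp only at *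
  have hlt : ∀ i, a i < d := fun i => (hmono (Fin.le_last i)).trans_lt h5
  have hdN : d ≤ N := by
    apply hN
    simp only [Set.mem_iUnion]
    rcases Nat.lt_or_ge d (2 * a 5) with hbig | hsmall
    · obtain ⟨m, hm5, hm⟩ := hqs.exists_add_eq hlt hbig
      exact ⟨_, hqs.isReducedWeights_of_complementary hd ha hsum hm5 hm
        fun i him hi5 => hqs.two_mul_le_of_complementary ha hlt hsum hbig hm5 hm hi5 him,
        m, 5, hd, a, coprimeOutside_of_gcd hgcd m 5, fun i him hi5 => by simp [him, hi5]⟩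
    · have hle : ∀ i, 2 * a i ≤ d := fun i =>
        (Nat.mul_le_mul_left 2 (hmono (Fin.le_last i))).trans hsmall
      exact ⟨_, hqs.isReducedWeights hd ha hsum hle, 0, 0, hd, a, coprimeOutside_of_gcd hgcd 0 0,
        fun _ _ _ => rfl⟩
  exact ⟨fun i => (hlt i).le.trans hdN, hdN⟩
end

section
/- Let a_0 ≤ a_1 ≤ ... ≤ a_5 and d be positive integers satisfying: a_5 < d; a_0 + ... + a_5 = 2d; the quasi-smoothness criterion (for every nonempty subset I of {0,...,5}, either d is a nonnegative integer linear combination of {a_i : i ∈ I}, or there exist at least |I| indices j ∉ I such that d − a_j is a nonnegative integer linear combination of {a_i : i ∈ I}); gcd of every four of the weights equals 1; gcd of every three of the weights divides d; and a_5 > 1. Then there exists an index i ∈ {0,...,4} such that a_i + a_5 = d. -/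
open Finset

/-- If, for every `t`, at most as many entries of `x` exceed `t` as are at most `-2 (t + 1)`, and
the entries have nonnegative sum, then they all vanish. -/
theorem eq_zero_of_card_layers_le {ι : Type*} [Fintype ι] (x : ι → ℤ)
    (h : ∀ t : ℕ, #{i | (t : ℤ) < x i} ≤ #{i | x i ≤ -(2 * (t + 1) : ℤ)})
    (h0 : 0 ≤ ∑ i, x i) (i : ι) : x i = 0 := by
  classical
  set T : ℕ := ∑ i, (x i).toNat with hT
  have hle : ∀ i, (x i).toNat ≤ T := fun i =>
    single_le_sum (f := fun i => (x i).toNat) (fun _ _ => Nat.zero_le _) (mem_univ i)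
  have hpos : ∑ t ∈ range T, #{i | (t : ℤ) < x i} = ∑ i, (x i).toNat := by
    simp only [card_filter]
    rw [sum_comm]
    refine sum_congr rfl fun i _ => ?_
    rw [← card_filter]
    have : (range T).filter (fun t : ℕ => (t : ℤ) < x i) = range (x i).toNat := by
      ext t
      have := hle i
      simp only [mem_filter, mem_range]
      omega
    rw [this, card_range]
  have hneg : ∑ t ∈ range T, #{i | x i ≤ -(2 * (t + 1) : ℤ)} ≤ ∑ i, (-x i).toNat / 2 := by
    simp only [card_filter]
    rw [sum_comm]
    refine sum_le_sum fun i _ => ?_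
    rw [← card_filter]
    have : (range T).filter (fun t : ℕ => x i ≤ -(2 * (t + 1) : ℤ))
        ⊆ range ((-x i).toNat / 2) := by
      intro t
      simp only [mem_filter, mem_range]
      omega
    simpa using card_le_card this
  have hPN : ∑ i, (x i).toNat ≤ ∑ i, (-x i).toNat / 2 :=
    hpos ▸ (sum_le_sum fun t _ => h t).trans hneg
  have h1 : ∀ i, (2 * ((-x i).toNat / 2 : ℕ) : ℤ) ≤ -x i + (x i).toNat := fun i => by omega
  have h2 := sum_le_sum fun i (_ : i ∈ univ) => h1 i
  rw [sum_add_distrib, sum_neg_distrib, ← mul_sum, ← Nat.cast_sum, ← Nat.cast_sum] at h2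
  have hzero : ∀ i, (x i).toNat = 0 := by
    have : ∑ i, (x i).toNat = 0 := by omega
    simpa using this
  have hnonpos : ∀ i ∈ univ, x i ≤ 0 := fun i _ => by have := hzero i; omega
  exact (sum_eq_zero_iff_of_nonpos hnonpos).1 (le_antisymm (sum_nonpos hnonpos) h0) i
    (mem_univ i)

/-- If a linear functional `x` is nonpositive on all exponent vectors of degree `d` monomials,
no monomial of degree `d` is a product of two distinct variables, and the coordinates of `x` have
nonnegative sum, then `x` vanishes. -/
theorem QuasiSmoothCrit.eq_zero_of_sum_nonneg {a : Fin 6 → ℕ} {d : ℕ}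
    (hqs : QuasiSmoothCrit a d) (hlt : ∀ i, a i < d)
    (hpair : ∀ i j, i ≠ j → a i + a j ≠ d) (x : Fin 6 → ℤ)
    (hx : ∀ c : Fin 6 → ℕ, ∑ i, c i * a i = d → ∑ i, (c i : ℤ) * x i ≤ 0)
    (h0 : 0 ≤ ∑ i, x i) (i : Fin 6) : x i = 0 := by
  refine eq_zero_of_card_layers_le x (fun t => ?_) h0 i
  set I : Finset (Fin 6) := {i | (t : ℤ) < x i} with hI
  have hIx : ∀ i ∈ I, (t : ℤ) + 1 ≤ x i := fun i hi => by
    have := (mem_filter.1 hi).2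
    omega
  have hlow : ∀ c : Fin 6 → ℕ,
      ((t : ℤ) + 1) * (∑ i ∈ I, c i : ℕ) ≤ ∑ i ∈ I, (c i : ℤ) * x i := fun c => by
    push_cast
    rw [mul_sum]
    refine sum_le_sum fun i hi => ?_
    rw [mul_comm]
    exact mul_le_mul_of_nonneg_left (hIx i hi) (by positivity)
  rcases I.eq_empty_or_nonempty with hE | hne
  · simp [hE]
  rcases hqs I hne with ⟨c, hc⟩ | ⟨J, hJI, hdisj, hJ⟩
  · exfalso
    have h1 := hx (fun i => if i ∈ I then c i else 0) (by simp [ite_mul, ← hc])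
    have h2 : ∑ i ∈ I, (c i : ℤ) * x i ≤ 0 := by simpa [ite_mul] using h1
    have h3 : 0 < ∑ i ∈ I, c i := by
      rw [Nat.pos_iff_ne_zero]
      intro h
      rw [sum_eq_zero_iff] at h
      rw [sum_eq_zero fun i hi => by simp [h i hi]] at hc
      exact absurd (hlt 0) (by omega)
    have h4 := hlow c
    have : (0 : ℤ) < (∑ i ∈ I, c i : ℕ) := by exact_mod_cast h3
    nlinarith
  · refine hJI.trans (card_le_card fun j hj => ?_)
    obtain ⟨c, hc⟩ := hJ j hj
    have hjI : j ∉ I := disjoint_left.1 hdisj hj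
    have h1 := hx (fun i => (if i = j then 1 else 0) + if i ∈ I then c i else 0)
      (by simp [add_mul, ite_mul, sum_add_distrib, ← hc])
    have h2 : x j + ∑ i ∈ I, (c i : ℤ) * x i ≤ 0 := by
      simpa [add_mul, ite_mul, sum_add_distrib] using h1
    have h3 : 2 ≤ ∑ i ∈ I, c i := by
      by_contra hcon
      have hex : ∃ i ∈ I, c i ≠ 0 := by
        by_contra! h
        rw [sum_eq_zero fun i hi => by simp [h i hi]] at hc
        exact absurd (hlt j) (by omega)
      obtain ⟨i, hi, hci⟩ := hex
      rw [← add_sum_erase I c hi] at hcon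
      have hrest : ∑ k ∈ I.erase i, c k = 0 := by omega
      have hci1 : c i = 1 := by omega
      rw [sum_eq_zero_iff] at hrest
      rw [← add_sum_erase I _ hi, sum_eq_zero fun k hk => by simp [hrest k hk], hci1] at hc
      exact hpair j i (fun h => hjI (h ▸ hi)) (by omega)
    have h4 := hlow c
    have : (2 : ℤ) ≤ (∑ i ∈ I, c i : ℕ) := by exact_mod_cast h3
    simp only [mem_filter, mem_univ, true_and]
    nlinarith


theorem QuasiSmoothCrit.singleton {a : Fin 6 → ℕ} {d : ℕ} (hqs : QuasiSmoothCrit a d)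
    (i : Fin 6) :
    (∃ k, d = k * a i) ∨ ∃ j, j ≠ i ∧ ∃ k, d = a j + k * a i := by
  rcases hqs {i} (singleton_nonempty i) with ⟨c, hc⟩ | ⟨J, hJ, hdisj, h⟩
  · exact Or.inl ⟨c i, by simpa using hc⟩
  · obtain ⟨j, hj⟩ : J.Nonempty := card_pos.1 (by simpa using hJ)
    obtain ⟨c, hc⟩ := h j hj
    refine Or.inr ⟨j, fun hji => ?_, c i, by simpa using hc⟩
    exact disjoint_left.1 hdisj hj (by simp [hji])

theorem mod_four_eq_two_of_mul_odd {k u : ℕ} (hu : u % 2 = 1) (h : k * u % 4 = 2) :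
    k % 4 = 2 := by
  rw [Nat.mul_mod] at h
  have h1 : u % 4 = 1 ∨ u % 4 = 3 := by omega
  rcases h1 with h1 | h1 <;> rw [h1] at h <;> omega

theorem mod_four_eq_zero_of_mul_odd {k u : ℕ} (hu : u % 2 = 1) (h : k * u % 4 = 0) :
    k % 4 = 0 := by
  rw [Nat.mul_mod] at h
  have h1 : u % 4 = 1 ∨ u % 4 = 3 := by omega
  rcases h1 with h1 | h1 <;> rw [h1] at h <;> omega

theorem mod_two_mul_odd {k u : ℕ} (hu : u % 2 = 1) : k * u % 2 = k % 2 := by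
  rw [Nat.mul_mod, hu]
  omega

theorem mod_two_mul_even {k e : ℕ} (he : e % 2 = 0) : k * e % 2 = 0 := by
  rw [Nat.mul_mod, he]
  omega

theorem mod_four_mul_of_mod_four_eq_zero {k e : ℕ} (he : e % 4 = 0) : k * e % 4 = 0 := by
  rw [Nat.mul_mod, he]
  omega

theorem mod_four_mul_of_mod_four_eq_two {k e : ℕ} (he : e % 4 = 2) :
    k * e % 4 = 2 * (k % 2) := by
  rw [Nat.mul_mod, he]
  omega

/-- The relations that an even weight `e` can satisfy by virtue of quasi-smoothness, `f` being the
other even weight. -/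
theorem even_weight_relation {d e f k : ℕ} (hd : d % 4 = 2) (he : e % 2 = 0) (hf : f % 2 = 0)
    (hed : 2 * e < d) (hfd : 2 * f < d) (h : d = k * e ∨ d = f + k * e) :
    (e % 4 = 2 ∧ 3 * e ≤ d ∧ (f % 4 = 0 → 3 * e = d ∨ 3 * e + f = d ∨ 5 * e ≤ d)) ∨
      (f % 4 = 2 ∧ 2 * e + f ≤ d) := by
  have hmul : ∀ m, m ≤ k → m * e ≤ k * e := fun m hm => Nat.mul_le_mul_right e hm
  have hk : 2 ≤ k := by
    by_contra hk
    have : k = 0 ∨ k = 1 := by omega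
    rcases this with rfl | rfl <;> omega
  have h2 := hmul 2 hk
  have hcase : e % 4 = 0 ∨ e % 4 = 2 := by omega
  rcases hcase with h4 | h4
  · have := mod_four_mul_of_mod_four_eq_zero (k := k) h4
    omega
  · have hm := mod_four_mul_of_mod_four_eq_two (k := k) h4
    have hcase : k = 2 ∨ k = 3 ∨ k = 4 ∨ 5 ≤ k := by omega
    rcases hcase with rfl | rfl | rfl | hk5
    · omega
    · omega
    · omega
    · have h5 := hmul 5 hk5
      omega

/-- The relations that an odd weight `u` can satisfy by virtue of quasi-smoothness when the degree
is twice an odd number and the relation involves an odd weight `v`. -/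
theorem odd_weight_relation_odd {d u v k : ℕ} (hd : d % 4 = 2) (hu : u % 2 = 1)
    (hv : v % 2 = 1) (hud : 2 * u < d) (hvd : 2 * v < d) (h : d = v + k * u) :
    3 * u + v = d ∨ 5 * u + v ≤ d := by
  have hm := mod_two_mul_odd (k := k) hu
  have hk : k % 2 = 1 := by omega
  have hcase : k = 1 ∨ k = 3 ∨ 5 ≤ k := by omega
  rcases hcase with rfl | rfl | hk5
  · omega
  · omega
  · have := Nat.mul_le_mul_right u hk5
    omega

/-- As `odd_weight_relation_odd`, for a pure power. -/
theorem odd_weight_relation_pure {d u k : ℕ} (hd : d % 4 = 2) (hu : u % 2 = 1)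
    (hud : 2 * u < d) (h : d = k * u) : 6 * u = d ∨ 10 * u ≤ d := by
  have hk : k % 4 = 2 := mod_four_eq_two_of_mul_odd hu (h ▸ hd)
  have hcase : k = 2 ∨ k = 6 ∨ 10 ≤ k := by omega
  rcases hcase with rfl | rfl | hk10
  · omega
  · omega
  · have := Nat.mul_le_mul_right u hk10
    omega

/-- As `odd_weight_relation_odd`, for a relation involving a weight divisible by four. -/
theorem odd_weight_relation_zero {d u e k : ℕ} (hd : d % 4 = 2) (hu : u % 2 = 1)
    (he : e % 4 = 0) (h : d = e + k * u) : 2 * u + e = d ∨ 6 * u + e ≤ d := by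
  have hk : k % 4 = 2 := mod_four_eq_two_of_mul_odd hu (by omega)
  have hcase : k = 2 ∨ 6 ≤ k := by omega
  rcases hcase with rfl | hk6
  · omega
  · have := Nat.mul_le_mul_right u hk6
    omega

/-- As `odd_weight_relation_odd`, for a relation involving an even weight not divisible by
four. -/
theorem odd_weight_relation_two {d u f k : ℕ} (hd : d % 4 = 2) (hu : u % 2 = 1)
    (hf : f % 4 = 2) (hfd : 2 * f < d) (h : d = f + k * u) :
    4 * u + f = d ∨ 8 * u + f ≤ d := by
  have hk : k % 4 = 0 := mod_four_eq_zero_of_mul_odd hu (by omega)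
  have hcase : k = 0 ∨ k = 4 ∨ 8 ≤ k := by omega
  rcases hcase with rfl | rfl | hk8
  · omega
  · omega
  · have := Nat.mul_le_mul_right u hk8
    omega

theorem false_of_sum_large {d u v w : ℕ} (hd : 0 < d) (hsum : 5 * d ≤ 6 * (u + v + w))
    (hu : 4 * u ≤ d ∨ 3 * u + v = d ∨ 3 * u + w = d)
    (hv : 4 * v ≤ d ∨ 3 * v + w = d ∨ 3 * v + u = d)
    (hw : 4 * w ≤ d ∨ 3 * w + u = d ∨ 3 * w + v = d) : False := by
  rcases hu with hu | hu | hu <;> rcases hv with hv | hv | hv <;>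
    rcases hw with hw | hw | hw <;> linarith

theorem false_of_large_weight {d u v w : ℕ} (hu : d < 4 * u) (hsum : d < 2 * (v + w))
    (hv : 4 * v ≤ d ∨ 3 * v + w = d ∨ 3 * v + u = d)
    (hw : 4 * w ≤ d ∨ 3 * w + u = d ∨ 3 * w + v = d) : False := by
  rcases hv with hv | hv | hv <;> rcases hw with hw | hw | hw <;> linarith

/-- All weights other than the last are less than the last one, which is odd and half the degree;
among them `e`, `f` index the even weights and `u`, `v`, `w` the odd ones. -/
structure OddHalfDegree (a : Fin 6 → ℕ) (d : ℕ) (e f u v w : Fin 6) : Prop where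
  qs : QuasiSmoothCrit a d
  cover : ∀ j, j = e ∨ j = f ∨ j = u ∨ j = v ∨ j = w ∨ j = 5
  uv : u ≠ v
  uw : u ≠ w
  vw : v ≠ w
  ef : e ≠ f
  even_e : a e % 2 = 0
  even_f : a f % 2 = 0
  odd_u : a u % 2 = 1
  odd_v : a v % 2 = 1
  odd_w : a w % 2 = 1
  odd_five : a 5 % 2 = 1
  deg : d = 2 * a 5
  lt_e : a e < a 5
  lt_f : a f < a 5
  lt_u : a u < a 5
  lt_v : a v < a 5
  lt_w : a w < a 5
  sum : a e + a f + a u + a v + a w = 3 * a 5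

namespace OddHalfDegree

variable {a : Fin 6 → ℕ} {d : ℕ} {e f u v w : Fin 6}

theorem swap_even (h : OddHalfDegree a d e f u v w) : OddHalfDegree a d f e u v w :=
  { h with
    cover := fun j => by have := h.cover j; tauto
    ef := h.ef.symm
    even_e := h.even_f
    even_f := h.even_e
    lt_e := h.lt_f
    lt_f := h.lt_e
    sum := by have := h.sum; omega }

theorem rotate (h : OddHalfDegree a d e f u v w) : OddHalfDegree a d e f v w u :=
  { h with
    cover := fun j => by have := h.cover j; tauto
    uv := h.vw
    uw := h.uv.symm
    vw := h.uw.symm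
    odd_u := h.odd_v
    odd_v := h.odd_w
    odd_w := h.odd_u
    lt_u := h.lt_v
    lt_v := h.lt_w
    lt_w := h.lt_u
    sum := by have := h.sum; omega }

theorem deg_mod_four (h : OddHalfDegree a d e f u v w) : d % 4 = 2 := by
  have := h.deg
  have := h.odd_five
  omega

theorem even_relation (h : OddHalfDegree a d e f u v w) :
    (a e % 4 = 2 ∧ 3 * a e ≤ d ∧
      (a f % 4 = 0 → 3 * a e = d ∨ 3 * a e + a f = d ∨ 5 * a e ≤ d)) ∨
      (a f % 4 = 2 ∧ 2 * a e + a f ≤ d) := by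
  have := h.deg
  have := h.lt_e
  have := h.lt_f
  have key : ∃ k, d = k * a e ∨ d = a f + k * a e := by
    rcases h.qs.singleton e with ⟨k, hk⟩ | ⟨j, hj, k, hk⟩
    · exact ⟨k, Or.inl hk⟩
    · have := mod_two_mul_even (k := k) h.even_e
      have := h.odd_u
      have := h.odd_v
      have := h.odd_w
      have := h.odd_five
      rcases h.cover j with rfl | rfl | rfl | rfl | rfl | rfl
      · exact absurd rfl hj
      · exact ⟨k, Or.inr hk⟩
      all_goals omega
  obtain ⟨k, hk⟩ := key
  exact even_weight_relation h.deg_mod_four h.even_e h.even_f (by omega) (by omega) hk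

theorem odd_relation (h : OddHalfDegree a d e f u v w) :
    (6 * a u = d ∨ 10 * a u ≤ d) ∨ (3 * a u + a v = d ∨ 5 * a u + a v ≤ d) ∨
      (3 * a u + a w = d ∨ 5 * a u + a w ≤ d) ∨
      (∃ g, (g = e ∨ g = f) ∧
        ((a g % 4 = 0 ∧ (2 * a u + a g = d ∨ 6 * a u + a g ≤ d)) ∨
        (a g % 4 = 2 ∧ (4 * a u + a g = d ∨ 8 * a u + a g ≤ d)))) := by
  have hd := h.deg
  have hd4 := h.deg_mod_four
  have := h.lt_u
  have := h.lt_v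
  have := h.lt_w
  have := h.lt_e
  have := h.lt_f
  have hue : 2 * a u < d := by omega
  have hev : ∀ g, a g % 2 = 0 → 2 * a g < d → ∀ k, d = a g + k * a u →
      (a g % 4 = 0 ∧ (2 * a u + a g = d ∨ 6 * a u + a g ≤ d)) ∨
      (a g % 4 = 2 ∧ (4 * a u + a g = d ∨ 8 * a u + a g ≤ d)) := by
    intro g hg hgd k hk
    have hcase : a g % 4 = 0 ∨ a g % 4 = 2 := by omega
    rcases hcase with h4 | h4
    · exact Or.inl ⟨h4, odd_weight_relation_zero hd4 h.odd_u h4 hk⟩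
    · exact Or.inr ⟨h4, odd_weight_relation_two hd4 h.odd_u h4 hgd hk⟩
  rcases h.qs.singleton u with ⟨k, hk⟩ | ⟨j, hj, k, hk⟩
  · exact Or.inl (odd_weight_relation_pure hd4 h.odd_u hue hk)
  · rcases h.cover j with rfl | rfl | rfl | rfl | rfl | rfl
    · exact Or.inr (Or.inr (Or.inr ⟨j, Or.inl rfl, hev j h.even_e (by omega) k hk⟩))
    · exact Or.inr (Or.inr (Or.inr ⟨j, Or.inr rfl, hev j h.even_f (by omega) k hk⟩))
    · exact absurd rfl hj
    · exact Or.inr (Or.inl (odd_weight_relation_odd hd4 h.odd_u h.odd_v hue (by omega) hk))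
    · exact Or.inr (Or.inr (Or.inl
        (odd_weight_relation_odd hd4 h.odd_u h.odd_w hue (by omega) hk)))
    · exact Or.inl (odd_weight_relation_pure (k := 2 * k) hd4 h.odd_u hue
        (by rw [mul_assoc]; omega))

/-- Some monomial of degree `d` involves the odd weights only, and it has degree at least four. -/
theorem exists_four_mul_le (h : OddHalfDegree a d e f u v w) :
    4 * a u ≤ d ∨ 4 * a v ≤ d ∨ 4 * a w ≤ d := by
  have hsum : ∀ c : Fin 6 → ℕ, ∑ i ∈ {u, v, w}, c i * a i
      = c u * a u + (c v * a v + c w * a w) := fun c => by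
    rw [sum_insert (by simp [h.uv, h.uw]), sum_pair h.vw]
  have key : ∃ α β γ, d = α * a u + (β * a v + γ * a w) := by
    rcases h.qs {u, v, w} (by simp) with ⟨c, hc⟩ | ⟨J, hJ, hdisj, hc⟩
    · exact ⟨_, _, _, hc.trans (hsum c)⟩
    · have h5 : (5 : Fin 6) ∈ J := by
        by_contra h5
        have hsub : J ⊆ {e, f} := fun j hj => by
          have h1 := disjoint_left.1 hdisj hj
          simp only [mem_insert, mem_singleton, not_or] at h1 ⊢
          rcases h.cover j with h | h | h | h | h | rfl
          all_goals tauto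
        have h2 := card_le_card hsub
        have h3 : #({e, f} : Finset (Fin 6)) ≤ 2 := card_le_two
        have h4 : #({u, v, w} : Finset (Fin 6)) = 3 :=
          card_eq_three.2 ⟨u, v, w, h.uv, h.uw, h.vw, rfl⟩
        omega
      obtain ⟨c, hc⟩ := hc 5 h5
      rw [hsum] at hc
      have := h.deg
      exact ⟨2 * c u, 2 * c v, 2 * c w, by simp only [mul_assoc]; omega⟩
  obtain ⟨α, β, γ, hc⟩ := key
  have hd := h.deg
  have h1 := h.lt_u
  have h2 := h.lt_v
  have h3 := h.lt_w
  have hm1 := mod_two_mul_odd (k := α) h.odd_u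
  have hm2 := mod_two_mul_odd (k := β) h.odd_v
  have hm3 := mod_two_mul_odd (k := γ) h.odd_w
  by_contra! hcon
  obtain ⟨g1, g2, g3⟩ := hcon
  have hlt : α + β + γ < 4 := by
    by_contra! h4
    nlinarith [Nat.mul_le_mul_right d h4, Nat.mul_le_mul_left α g1.le,
      Nat.mul_le_mul_left β g2.le, Nat.mul_le_mul_left γ g3.le]
  have hα : α < 4 := by omega
  have hβ : β < 4 := by omega
  have hγ : γ < 4 := by omega
  interval_cases α <;> interval_cases β <;> interval_cases γ <;> omega

/-- Two odd weights `s` larger than a third of the degree cannot both rely on the relation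
`2 * s + a e = d`. -/
theorem false_of_three_mul_lt (h : OddHalfDegree a d e f u v w) (he : a e % 4 = 0)
    (hf : a f % 4 = 2) (hu : 2 * a u + a e = d) (hv : 2 * a v + a e = d)
    (hlt : 3 * a e < d) : False := by
  have hsum : ∀ c : Fin 6 → ℕ, ∑ i ∈ {u, v}, c i * a i = (c u + c v) * a u := fun c => by
    rw [sum_pair h.uv, show a v = a u by omega, add_mul]
  have hd := h.deg
  have h1 := h.lt_u
  have hle : ∀ m, 3 ≤ m → 3 * a u ≤ m * a u := fun m hm => Nat.mul_le_mul_right _ hm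
  have hsmall : ∀ m, m = 0 ∨ m = 1 ∨ m = 2 ∨ 3 ≤ m := fun m => by omega
  rcases h.qs {u, v} (by simp) with ⟨c, hc⟩ | ⟨J, hJ, hdisj, hc⟩
  · rw [hsum] at hc
    have := hle (c u + c v)
    rcases hsmall (c u + c v) with h0 | h0 | h0 | h0
    · rw [h0] at hc; omega
    · rw [h0] at hc; omega
    · rw [h0] at hc; omega
    · omega
  · have hsub : J ⊆ {e} := fun j hj => by
      obtain ⟨c, hc⟩ := hc j hj
      rw [hsum] at hc
      have h2 := h.lt_e
      have h3 := h.lt_f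
      have h4 := h.lt_w
      have hj5 : a j ≤ a 5 := by
        have := h.lt_v
        rcases h.cover j with rfl | rfl | rfl | rfl | rfl | rfl <;> omega
      have hje : a j = a e := by
        have := hle (c u + c v)
        rcases hsmall (c u + c v) with h0 | h0 | h0 | h0
        · rw [h0] at hc; omega
        · rw [h0] at hc; omega
        · rw [h0] at hc; omega
        · omega
      have := h.odd_u
      have := h.odd_v
      have := h.odd_w
      have := h.odd_five
      rcases h.cover j with rfl | rfl | rfl | rfl | rfl | rfl
      · simp
      all_goals omega
    have h2 := card_le_card hsub
    rw [card_pair h.uv] at hJ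
    simp at h2
    omega

theorem false_of_two_mul_add (h : OddHalfDegree a d e f u v w) (he : a e % 4 = 0)
    (hf : a f % 4 = 2) (hu : 2 * a u + a e = d) (hv : 2 * a v + a e = d) : False := by
  refine h.false_of_three_mul_lt he hf hu hv ?_
  have he2 : 2 * a e + a f ≤ d := by
    have := h.even_relation
    omega
  have hf3 : 3 * a f ≤ d ∧ (3 * a f = d ∨ 3 * a f + a e = d ∨ 5 * a f ≤ d) := by
    have := h.swap_even.even_relation
    omega
  have hfw : 2 * (a f + a w) = d := by
    have := h.sum
    have := h.deg
    omega
  have hw : 6 * a w = d ∨ 3 * a w + a u = d ∨ 2 * a w + a e = d := by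
    have hpos : 0 < a f := by omega
    have hvu : a v = a u := by omega
    clear hv
    rcases h.rotate.rotate.odd_relation with
      (h3 | h3) | (h3 | h3) | (h3 | h3) | ⟨g, rfl | rfl, ⟨h4, h3 | h3⟩ | ⟨h4, h3 | h3⟩⟩ <;>
      clear h <;> omega
  have hmin : 4 * a u ≤ d ∨ 4 * a w ≤ d := by
    have := h.exists_four_mul_le
    omega
  clear h hv
  obtain ⟨hf3, hfc⟩ := hf3
  rcases hw with hw | hw | hw
  · omega
  · rcases hfc with hfc | hfc | hfc <;> omega
  · rcases hmin with hm | hm <;> omega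

theorem false_of_mod_four_zero_two (h : OddHalfDegree a d e f u v w) (he : a e % 4 = 0)
    (hf : a f % 4 = 2) : False := by
  have coarse : ∀ {u v w : Fin 6}, OddHalfDegree a d e f u v w →
      2 * a u + a e = d ∨ 4 * a u ≤ d ∨ 3 * a u + a v = d ∨ 3 * a u + a w = d := by
    intro u v w h
    have := h.odd_relation
    rcases this with h3 | h3 | h3 | ⟨g, rfl | rfl, h3⟩ <;> omega
  have he2 : 2 * a e + a f ≤ d := by
    have := h.even_relation
    omega
  have hf3 : 3 * a f ≤ d := by
    have := h.swap_even.even_relation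
    omega
  have hne : a e ≠ a f := by omega
  have two : ∀ {u v w : Fin 6}, OddHalfDegree a d e f u v w → 2 * a u + a e ≠ d := by
    intro u v w h hu
    have hv : 2 * a v + a e ≠ d := fun hv => h.false_of_two_mul_add he hf hu hv
    have hw : 2 * a w + a e ≠ d := fun hw => h.rotate.rotate.false_of_two_mul_add he hf hw hu
    have cv := (coarse h.rotate).resolve_left hv
    have cw := (coarse h.rotate.rotate).resolve_left hw
    have hs := h.sum
    have hd := h.deg
    have hle := h.lt_e
    refine false_of_large_weight (d := d) (u := a u) (v := a v) (w := a w) (by omega)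
      (by omega) (by omega) (by omega)
  have cu := (coarse h).resolve_left (two h)
  have cv := (coarse h.rotate).resolve_left (two h.rotate)
  have cw := (coarse h.rotate.rotate).resolve_left (two h.rotate.rotate)
  have hs := h.sum
  have hd := h.deg
  exact false_of_sum_large (d := d) (u := a u) (v := a v) (w := a w) (by omega) (by omega) cu cv cw

theorem false_of_mod_four_two_two (h : OddHalfDegree a d e f u v w) (he : a e % 4 = 2)
    (hf : a f % 4 = 2) : False := by
  have coarse : ∀ {u v w : Fin 6}, OddHalfDegree a d e f u v w →
      4 * a u ≤ d ∨ 3 * a u + a v = d ∨ 3 * a u + a w = d := by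
    intro u v w h
    have := h.odd_relation
    rcases this with h3 | h3 | h3 | ⟨g, rfl | rfl, h3⟩ <;> omega
  have hef : 3 * (a e + a f) ≤ 2 * d := by
    have h1 := h.even_relation
    have h2 := h.swap_even.even_relation
    omega
  have hs := h.sum
  have hd := h.deg
  have := h.lt_u
  exact false_of_sum_large (d := d) (u := a u) (v := a v) (w := a w) (by omega) (by omega)
    (coarse h) (coarse h.rotate) (coarse h.rotate.rotate)

end OddHalfDegree

theorem OddHalfDegree.false {a : Fin 6 → ℕ} {d : ℕ} {e f u v w : Fin 6}
    (h : OddHalfDegree a d e f u v w) : False := by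
  have h1 := h.even_e
  have h2 := h.even_f
  have h3 := h.even_relation
  have h4 : (a e % 4 = 0 ∧ a f % 4 = 2) ∨ (a f % 4 = 0 ∧ a e % 4 = 2) ∨
    (a e % 4 = 2 ∧ a f % 4 = 2) := by omega
  rcases h4 with ⟨he, hf⟩ | ⟨hf, he⟩ | ⟨he, hf⟩
  · exact h.false_of_mod_four_zero_two he hf
  · exact h.swap_even.false_of_mod_four_zero_two hf he
  · exact h.false_of_mod_four_two_two he hf

theorem two_mul_le_of_forall_add_ne {a : Fin 6 → ℕ} {d : ℕ} (hqs : QuasiSmoothCrit a d)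
    (h : ∀ i, a i < d) (hne : ∀ i, i ≠ 5 → a i + a 5 ≠ d) : 2 * a 5 ≤ d := by
  rcases hqs.singleton 5 with ⟨k, hk⟩ | ⟨j, hj, k, hk⟩
  · have hk2 : 2 ≤ k := by
      by_contra hk2
      have := h 5
      have hcase : k = 0 ∨ k = 1 := by omega
      rcases hcase with rfl | rfl <;> omega
    have := Nat.mul_le_mul_right (a 5) hk2
    omega
  · have hk2 : 2 ≤ k := by
      by_contra hk2
      have := h j
      have := hne j hj
      have hcase : k = 0 ∨ k = 1 := by omega
      rcases hcase with rfl | rfl <;> omega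
    have := Nat.mul_le_mul_right (a 5) hk2
    omega

theorem QuasiSmoothCrit.three_mul_eq {a : Fin 6 → ℕ} {d : ℕ} (hqs : QuasiSmoothCrit a d)
    (hd : 0 < d) (hsum : ∑ i, a i = 2 * d) (hlt : ∀ i, 2 * a i < d) (i : Fin 6) :
    3 * a i = d := by
  have key := hqs.eq_zero_of_sum_nonneg (fun i => by have := hlt i; omega)
    (fun i j _ => by have := hlt i; have := hlt j; omega) (fun i => 3 * (a i : ℤ) - d)
    (fun c hc => by
      have h3 : 3 ≤ ∑ i, c i := by
        have h1 : ∑ i, c i * (2 * a i) ≤ ∑ i, c i * d :=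
          sum_le_sum fun i _ => Nat.mul_le_mul_left _ (hlt i).le
        have h2 : ∑ i, c i * (2 * a i) = 2 * d := by
          rw [← hc, mul_sum]
          exact sum_congr rfl fun i _ => by ring
        rw [h2, ← sum_mul] at h1
        by_contra hcon
        have hne : ∃ i, c i ≠ 0 := by
          by_contra! h
          simp [h] at hc
          omega
        obtain ⟨i, hi⟩ := hne
        have h4 : ∑ i, c i * (2 * a i) < ∑ i, c i * d :=
          sum_lt_sum (fun i _ => Nat.mul_le_mul_left _ (hlt i).le)
            ⟨i, mem_univ i, Nat.mul_lt_mul_of_pos_left (hlt i) (Nat.pos_of_ne_zero hi)⟩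
        rw [h2, ← sum_mul] at h4
        have : ∑ i, c i < 3 := by omega
        nlinarith
      have hc' : ∑ i, (c i : ℤ) * a i = d := by exact_mod_cast hc
      have h3' : (3 : ℤ) ≤ ∑ i, (c i : ℤ) := by exact_mod_cast h3
      have : ∑ i, (c i : ℤ) * (3 * (a i : ℤ) - d)
          = 3 * ∑ i, (c i : ℤ) * a i - (∑ i, (c i : ℤ)) * d := by
        rw [mul_sum, sum_mul, ← sum_sub_distrib]
        exact sum_congr rfl fun i _ => by ring
      rw [this, hc']
      nlinarith)
    (by
      have h : ∑ i, (a i : ℤ) = 2 * d := by exact_mod_cast hsum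
      simp [sum_sub_distrib, ← mul_sum, h]
      omega) i
  have key' : 3 * (a i : ℤ) - d = 0 := key
  omega

/-- If the largest weight is even and equals half the degree, then at most two weights are odd. -/
theorem QuasiSmoothCrit.card_odd_le {a : Fin 6 → ℕ} {d : ℕ} (hqs : QuasiSmoothCrit a d)
    (hsum : ∑ i, a i = 2 * d) (h5 : d = 2 * a 5) (hlt : ∀ i, i ≠ 5 → a i < a 5)
    (hpos : 0 < a 5) (heven : a 5 % 2 = 0) : ∑ i, a i % 2 ≤ 2 := by
  have hle : ∀ i, a i ≤ a 5 := fun i => by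
    by_cases h : i = 5
    · rw [h]
    · exact (hlt i h).le
  have hsum' : ∑ i, (a i : ℤ) = 2 * d := by exact_mod_cast hsum
  have hpar : (∑ i, a i % 2) % 2 = 0 := by
    rw [← sum_nat_mod, hsum]
    omega
  by_contra hcon
  have h4 : 4 ≤ ∑ i, a i % 2 := by omega
  have h4' : (4 : ℤ) ≤ ∑ i, ((a i % 2 : ℕ) : ℤ) := by exact_mod_cast h4
  have key := hqs.eq_zero_of_sum_nonneg (fun i => by have := hle i; omega)
    (fun i j hij => by
      have := hle i
      have := hle j
      by_cases hi : i = 5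
      · have := hlt j (fun hj => hij (hi.trans hj.symm))
        omega
      · have := hlt i hi
        omega)
    (fun i => 4 * (a i : ℤ) - d * (2 - (a i % 2 : ℕ)))
    (fun c hc => by
      set s : ℕ := ∑ i, c i * (2 - a i % 2) with hs
      have hpt : ∀ i, a i + 1 ≤ (2 - a i % 2) * a 5 := fun i => by
        rcases Nat.mod_two_eq_zero_or_one (a i) with h | h
        · have := hle i
          rw [h]
          omega
        · have := hlt i (fun hi => by rw [hi] at h; omega)
          rw [h]
          omega
      have hmod : s % 2 = 0 := by
        have h1 : (∑ i, (c i * (2 - a i % 2) + c i * a i)) % 2 = 0 := by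
          have h2 : ∀ i, (c i * (2 - a i % 2) + c i * a i) % 2 = 0 := fun i => by
            rw [← mul_add]
            exact mod_two_mul_even (by omega)
          simp [sum_nat_mod, h2]
        rw [sum_add_distrib, hc] at h1
        omega
      have hlow : d + ∑ i, c i ≤ s * a 5 := by
        rw [← hc, hs, sum_mul, ← sum_add_distrib]
        refine sum_le_sum fun i _ => ?_
        calc c i * a i + c i = c i * (a i + 1) := by ring
          _ ≤ c i * ((2 - a i % 2) * a 5) := Nat.mul_le_mul_left _ (hpt i)
          _ = _ := by ring
      have hcpos : 0 < ∑ i, c i := by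
        rw [Nat.pos_iff_ne_zero]
        intro h
        rw [sum_eq_zero_iff] at h
        rw [sum_eq_zero fun i hi => by simp [h i hi]] at hc
        omega
      have hs4 : 4 ≤ s := by
        have : 2 < s := by
          by_contra hle2
          have := Nat.mul_le_mul_right (a 5) (not_lt.1 hle2)
          omega
        omega
      have hc' : ∑ i, (c i : ℤ) * a i = d := by exact_mod_cast hc
      have hs' : (s : ℤ) = ∑ i, (c i : ℤ) * (2 - (a i % 2 : ℕ)) := by
        rw [hs, Nat.cast_sum]
        refine sum_congr rfl fun i _ => ?_
        rw [Nat.cast_mul, Nat.cast_sub (by omega)]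
        rfl
      have : ∑ i, (c i : ℤ) * (4 * (a i : ℤ) - d * (2 - (a i % 2 : ℕ)))
          = 4 * ∑ i, (c i : ℤ) * a i - d * s := by
        rw [hs', mul_sum, mul_sum, ← sum_sub_distrib]
        exact sum_congr rfl fun i _ => by ring
      rw [this, hc']
      have : (4 : ℤ) ≤ s := by exact_mod_cast hs4
      nlinarith)
    (by
      have : ∑ i, (4 * (a i : ℤ) - d * (2 - (a i % 2 : ℕ)))
          = 4 * ∑ i, (a i : ℤ) - d * (12 - ∑ i, ((a i % 2 : ℕ) : ℤ)) := by
        rw [show (12 : ℤ) = ∑ _i : Fin 6, 2 by simp, ← sum_sub_distrib, mul_sum, mul_sum,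
          ← sum_sub_distrib]
      rw [this, hsum']
      nlinarith)
  have hodd : ∀ i, i ≠ 5 → a i % 2 = 1 := fun i hi => by
    have h1 := key i
    have h2 := hlt i hi
    rcases Nat.mod_two_eq_zero_or_one (a i) with h | h
    · simp only [h] at h1
      push_cast at h1
      omega
    · exact h
  rw [Fin.sum_univ_six, hodd 0 (by decide), hodd 1 (by decide), hodd 2 (by decide),
    hodd 3 (by decide), hodd 4 (by decide)] at hpar
  omega

/-- If the largest weight is half the degree, then not all weights are odd. -/
theorem QuasiSmoothCrit.not_forall_odd {a : Fin 6 → ℕ} {d : ℕ} (hqs : QuasiSmoothCrit a d)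
    (hsum : ∑ i, a i = 2 * d) (h5 : d = 2 * a 5) (hlt : ∀ i, i ≠ 5 → a i < a 5)
    (hodd : ∀ i, a i % 2 = 1) : False := by
  have hle : ∀ i, a i ≤ a 5 := fun i => by
    by_cases h : i = 5
    · rw [h]
    · exact (hlt i h).le
  have l0 := hlt 0 (by decide)
  have l1 := hlt 1 (by decide)
  have l2 := hlt 2 (by decide)
  have l3 := hlt 3 (by decide)
  have l4 := hlt 4 (by decide)
  rw [Fin.sum_univ_six] at hsum
  have key := hqs.eq_zero_of_sum_nonneg (fun i => by have := hle i; omega)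
    (fun i j hij => by
      have := hle i
      have := hle j
      by_cases hi : i = 5
      · have := hlt j (fun hj => hij (hi.trans hj.symm))
        omega
      · have := hlt i hi
        omega)
    (fun i => 4 * (a i : ℤ) - d * if i = 5 then 2 else 1)
    (fun c hc => by
      rw [Fin.sum_univ_six] at hc
      have hpar : (c 0 + c 1 + c 2 + c 3 + c 4 + c 5) % 2 = 0 := by
        have m0 := mod_two_mul_odd (k := c 0) (hodd 0)
        have m1 := mod_two_mul_odd (k := c 1) (hodd 1)
        have m2 := mod_two_mul_odd (k := c 2) (hodd 2)
        have m3 := mod_two_mul_odd (k := c 3) (hodd 3)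
        have m4 := mod_two_mul_odd (k := c 4) (hodd 4)
        have m5 := mod_two_mul_odd (k := c 5) (hodd 5)
        clear hsum l0 l1 l2 l3 l4
        omega
      have hb : ∀ i, i ≠ 5 → c i * a i + c i ≤ c i * a 5 := fun i hi => by
        have := Nat.mul_le_mul_left (c i) (hlt i hi)
        rwa [Nat.mul_succ] at this
      have b0 := hb 0 (by decide)
      have b1 := hb 1 (by decide)
      have b2 := hb 2 (by decide)
      have b3 := hb 3 (by decide)
      have b4 := hb 4 (by decide)
      obtain ⟨s, hs⟩ : ∃ s, s = c 0 + c 1 + c 2 + c 3 + c 4 := ⟨_, rfl⟩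
      have hsa : (c 0 * a 0 + c 1 * a 1 + c 2 * a 2 + c 3 * a 3 + c 4 * a 4) + s ≤ s * a 5 := by
        rw [hs]
        linarith
      have h4 : 4 ≤ c 0 + c 1 + c 2 + c 3 + c 4 + 2 * c 5 := by
        rw [← hs] at hpar ⊢
        generalize c 0 * a 0 + c 1 * a 1 + c 2 * a 2 + c 3 * a 3 + c 4 * a 4 = p at hc hsa
        clear b0 b1 b2 b3 b4 hb hs
        by_contra! hcon
        have hcase : (c 5 = 0 ∧ s = 0) ∨ (c 5 = 0 ∧ s = 2) ∨ (c 5 = 1 ∧ s = 1) := by omega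
        rcases hcase with ⟨h, rfl⟩ | ⟨h, rfl⟩ | ⟨h, rfl⟩ <;> rw [h] at hc <;> omega
      have hc' : (c 0 : ℤ) * a 0 + c 1 * a 1 + c 2 * a 2 + c 3 * a 3 + c 4 * a 4
          + c 5 * a 5 = d := by exact_mod_cast hc
      have h4' : (4 : ℤ) ≤ c 0 + c 1 + c 2 + c 3 + c 4 + 2 * c 5 := by exact_mod_cast h4
      rw [Fin.sum_univ_six]
      simp only [Fin.isValue, Fin.reduceEq, if_true, if_false]
      nlinarith [mul_le_mul_of_nonneg_left h4' (Int.natCast_nonneg d)])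
    (by
      rw [Fin.sum_univ_six]
      simp only [Fin.isValue, Fin.reduceEq, if_true, if_false]
      omega)
  have k0 := key 0
  have k1 := key 1
  have k2 := key 2
  have k3 := key 3
  have k4 := key 4
  simp only [Fin.isValue, Fin.reduceEq, if_false] at k0 k1 k2 k3 k4
  omega

/-- If the largest weight is odd and equals half the degree, then at most two weights are odd. -/
theorem QuasiSmoothCrit.card_odd_le_of_odd {a : Fin 6 → ℕ} {d : ℕ} (hqs : QuasiSmoothCrit a d)
    (hsum : ∑ i, a i = 2 * d) (h5 : d = 2 * a 5) (hlt : ∀ i, i ≠ 5 → a i < a 5)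
    (h5odd : a 5 % 2 = 1) : ∑ i, a i % 2 ≤ 2 := by
  have hcard : ∀ s : Finset (Fin 6), ∑ i ∈ s, a i % 2 = #{i ∈ s | a i % 2 = 1} := fun s => by
    rw [card_filter]
    refine sum_congr rfl fun i _ => ?_
    split_ifs <;> omega
  have hpar : (∑ i, a i % 2) % 2 = 0 := by
    rw [← sum_nat_mod, hsum]
    omega
  have hsplit : a 5 % 2 + ∑ i ∈ univ.erase 5, a i % 2 = ∑ i, a i % 2 :=
    add_sum_erase univ (fun i => a i % 2) (mem_univ 5)
  have hce : #((univ : Finset (Fin 6)).erase 5) = 5 := rfl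
  have htot := card_filter_add_card_filter_not (s := (univ : Finset (Fin 6)).erase 5)
    (fun i => a i % 2 = 1)
  rw [hcard] at hsplit
  by_contra hcon
  have hcase : #{i ∈ (univ : Finset (Fin 6)).erase 5 | a i % 2 = 1} = 5 ∨
      #{i ∈ (univ : Finset (Fin 6)).erase 5 | a i % 2 = 1} = 3 := by omega
  rcases hcase with h | h
  · refine hqs.not_forall_odd hsum h5 hlt fun i => ?_
    by_cases hi : i = 5
    · rw [hi, h5odd]
    · exact card_filter_eq_iff.1 (h.trans hce.symm) i (mem_erase.2 ⟨hi, mem_univ i⟩)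
  · have h2 : #{i ∈ (univ : Finset (Fin 6)).erase 5 | ¬ a i % 2 = 1} = 2 := by omega
    obtain ⟨u, v, w, huv, huw, hvw, hU⟩ := card_eq_three.1 h
    obtain ⟨e, f, hef, hE⟩ := card_eq_two.1 h2
    have hmemU : ∀ i, (i ≠ 5 ∧ a i % 2 = 1) ↔ i = u ∨ i = v ∨ i = w := fun i => by
      simpa using Finset.ext_iff.1 hU i
    have hmemE : ∀ i, (i ≠ 5 ∧ a i % 2 = 0) ↔ i = e ∨ i = f := fun i => by
      simpa using Finset.ext_iff.1 hE i
    have hu := (hmemU u).2 (by simp)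
    have hv := (hmemU v).2 (by simp)
    have hw := (hmemU w).2 (by simp)
    have he := (hmemE e).2 (by simp)
    have hf := (hmemE f).2 (by simp)
    have hs : ∑ i, a i = a 5 + ((a u + (a v + a w)) + (a e + a f)) := by
      rw [← add_sum_erase univ a (mem_univ 5), ← sum_filter_add_sum_filter_not _
        (fun i => a i % 2 = 1), hU, hE, sum_insert (by simp [huv, huw]), sum_pair hvw,
        sum_pair hef]
    have hsum' : a e + a f + a u + a v + a w = 3 * a 5 := by
      clear hpar hsplit hcard htot hce h h2 hcon hu hv hw he hf
      omega
    have hcover : ∀ j, j = e ∨ j = f ∨ j = u ∨ j = v ∨ j = w ∨ j = 5 := fun j => by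
      by_cases hj : j = 5
      · simp [hj]
      · rcases Nat.mod_two_eq_zero_or_one (a j) with h | h
        · rcases (hmemE j).1 ⟨hj, h⟩ with h | h <;> simp [h]
        · rcases (hmemU j).1 ⟨hj, h⟩ with h | h | h <;> simp [h]
    exact OddHalfDegree.false
      { qs := hqs
        cover := hcover
        uv := huv
        uw := huw
        vw := hvw
        ef := hef
        even_e := he.2
        even_f := hf.2
        odd_u := hu.2
        odd_v := hv.2
        odd_w := hw.2
        odd_five := h5odd
        deg := h5
        lt_e := hlt e he.1
        lt_f := hlt f hf.1
        lt_u := hlt u hu.1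
        lt_v := hlt v hv.1
        lt_w := hlt w hw.1
        sum := hsum' }

/-- If every four weights are coprime, then at least three weights are odd. -/
theorem two_lt_sum_mod_two_of_gcd {a : Fin 6 → ℕ}
    (hgcd4 : ∀ i j k l : Fin 6, i < j → j < k → k < l →
      Nat.gcd (a i) (Nat.gcd (a j) (Nat.gcd (a k) (a l))) = 1) : 2 < ∑ i, a i % 2 := by
  by_contra hcon
  have hcard : ∑ i, a i % 2 + #{i | a i % 2 = 0} = 6 := by
    rw [card_filter, ← sum_add_distrib, sum_congr rfl (g := fun _ => 1)]
    · simp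
    · intro i _
      split_ifs <;> omega
  obtain ⟨t, ht, ht4⟩ := exists_subset_card_eq (show 4 ≤ #{i | a i % 2 = 0} by omega)
  have hmem : ∀ i : Fin 4, 2 ∣ a (t.orderEmbOfFin ht4 i) := fun i =>
    Nat.dvd_of_mod_eq_zero (mem_filter.1 (ht (orderEmbOfFin_mem t ht4 i))).2
  have h1 := hgcd4 _ _ _ _ ((t.orderEmbOfFin ht4).strictMono (show (0 : Fin 4) < 1 by decide))
    ((t.orderEmbOfFin ht4).strictMono (show (1 : Fin 4) < 2 by decide))
    ((t.orderEmbOfFin ht4).strictMono (show (2 : Fin 4) < 3 by decide))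
  have h2 := Nat.dvd_gcd (hmem 0) (Nat.dvd_gcd (hmem 1) (Nat.dvd_gcd (hmem 2) (hmem 3)))
  rw [h1] at h2
  omega

/-- Under the numerical conditions for an FK3 weighted fourfold with singular
locus of dimension at most one and a₅ > 1, some weight aᵢ (i ≤ 4) satisfies
aᵢ + a₅ = d. -/
theorem stmt_15 (a : Fin 6 → ℕ) (d : ℕ)
    (hapos : ∀ i, 0 < a i) (hd : 0 < d) (hmono : Monotone a)
    (h5lt : a 5 < d) (hsum : ∑ i, a i = 2 * d)
    (hqs : QuasiSmoothCrit a d)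
    (hgcd4 : ∀ i j k l : Fin 6, i < j → j < k → k < l →
      Nat.gcd (a i) (Nat.gcd (a j) (Nat.gcd (a k) (a l))) = 1)
    (hgcd3 : ∀ i j k : Fin 6, i < j → j < k →
      Nat.gcd (a i) (Nat.gcd (a j) (a k)) ∣ d)
    (h5 : 1 < a 5) :
    ∃ i : Fin 6, (i : ℕ) ≤ 4 ∧ a i + a 5 = d := by
  by_contra! hcon
  have hne : ∀ i, i ≠ 5 → a i + a 5 ≠ d := fun i hi => hcon i (by omega)
  have hle : ∀ i, a i ≤ a 5 := fun i => hmono (Fin.le_last i)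
  have h2 := two_mul_le_of_forall_add_ne hqs (fun i => (hle i).trans_lt h5lt) hne
  rcases h2.lt_or_eq with hlt | heq
  · have h3 := hqs.three_mul_eq hd hsum fun i => by have := hle i; omega
    have heq : ∀ i, a i = a 5 := fun i => by
      have := h3 i
      have := h3 5
      omega
    have := hgcd4 0 1 2 3 (by decide) (by decide) (by decide)
    rw [heq 0, heq 1, heq 2, heq 3] at this
    simp only [Nat.gcd_self] at this
    omega
  · have hlt : ∀ i, i ≠ 5 → a i < a 5 := fun i hi => by
      have := hle i
      have := hne i hi
      omega
    have hodd := two_lt_sum_mod_two_of_gcd hgcd4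
    rcases Nat.mod_two_eq_zero_or_one (a 5) with h | h
    · have := hqs.card_odd_le hsum heq.symm hlt (by omega) h
      omega
    · have := hqs.card_odd_le_of_odd hsum heq.symm hlt h
      omega
end

section
/- Let a_0 ≤ a_1 ≤ ... ≤ a_5 and d be positive integers satisfying: a_5 < d; a_0 + ... + a_5 = 2d; d = 2*a_5; the quasi-smoothness criterion (for every nonempty subset I of {0,...,5}, either d is a nonnegative integer linear combination of {a_i : i ∈ I}, or there exist at least |I| indices j ∉ I such that d − a_j is a nonnegative integer linear combination of {a_i : i ∈ I}); gcd of every four of the weights equals 1; and gcd of every three of the weights divides d. Then a_4 divides d. -/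
/-- Every weight divides the degree up to one further weight. -/
lemma QuasiSmoothCrit.exists_pointer {a : Fin 6 → ℕ} {d : ℕ} (hqs : QuasiSmoothCrit a d)
    (hd5 : d = 2 * a 5) (i : Fin 6) :
    ∃ c, d = c * a i ∨ ∃ j, j ≠ i ∧ j ≠ 5 ∧ d = a j + c * a i := by
  rcases hqs {i} (Finset.singleton_nonempty i) with ⟨c, hc⟩ | ⟨J, hJ, hdisj, h⟩
  · exact ⟨c i, .inl (by simpa using hc)⟩
  · obtain ⟨j, hj⟩ := Finset.card_pos.1 (lt_of_lt_of_le (by simp) hJ)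
    obtain ⟨c, hc⟩ := h j hj
    rw [Finset.sum_singleton] at hc
    by_cases h5 : j = 5
    · subst h5
      exact ⟨2 * c i, .inl (by rw [mul_assoc]; omega)⟩
    · refine ⟨c i, .inr ⟨j, ?_, h5, hc⟩⟩
      rintro rfl
      exact Finset.disjoint_left.1 hdisj hj (Finset.mem_singleton_self _)

/-- Two equal weights divide the degree up to two distinct further weights. -/
lemma QuasiSmoothCrit.exists_pointers_of_eq {a : Fin 6 → ℕ} {d : ℕ} (hqs : QuasiSmoothCrit a d)
    (hd5 : d = 2 * a 5) {i k : Fin 6} (hik : i ≠ k) (heq : a i = a k) :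
    (∃ c, d = c * a i) ∨ ∃ j l, j < l ∧ l ≠ 5 ∧ j ≠ i ∧ j ≠ k ∧ l ≠ i ∧ l ≠ k ∧
      (∃ c, d = a j + c * a i) ∧ ∃ c, d = a l + c * a i := by
  have hpair (c : Fin 6 → ℕ) : ∑ x ∈ {i, k}, c x * a x = (c i + c k) * a i := by
    rw [Finset.sum_pair hik, ← heq, add_mul]
  rcases hqs {i, k} (Finset.insert_nonempty _ _) with ⟨c, hc⟩ | ⟨J, hJ, hdisj, h⟩
  · exact .inl ⟨c i + c k, by rw [hc, hpair]⟩
  · have hmem : ∀ j ∈ J, (j ≠ i ∧ j ≠ k) ∧ ∃ c, d = a j + c * a i := by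
      intro j hj
      obtain ⟨c, hc⟩ := h j hj
      refine ⟨by simpa using Finset.disjoint_left.1 hdisj hj, c i + c k, ?_⟩
      rw [hc, hpair]
    by_cases h5 : 5 ∈ J
    · obtain ⟨c, hc⟩ := (hmem 5 h5).2
      exact .inl ⟨2 * c, by rw [mul_assoc]; omega⟩
    · rw [Finset.card_pair hik] at hJ
      obtain ⟨j, hj, l, hl, hjl⟩ := Finset.one_lt_card.1 (show 1 < J.card by omega)
      have h5' : ∀ x ∈ J, x ≠ 5 := fun x hx hx5 => h5 (hx5 ▸ hx)
      rcases lt_or_gt_of_ne hjl with hlt | hlt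
      · exact .inr ⟨j, l, hlt, h5' l hl, (hmem j hj).1.1, (hmem j hj).1.2, (hmem l hl).1.1,
          (hmem l hl).1.2, (hmem j hj).2, (hmem l hl).2⟩
      · exact .inr ⟨l, j, hlt, h5' j hj, (hmem l hl).1.1, (hmem l hl).1.2, (hmem j hj).1.1,
          (hmem j hj).1.2, (hmem l hl).2, (hmem j hj).2⟩

/-- A multiple of `x` that is at most `2 * m` has a coefficient below any `K` with
`2 * m < K * x`. -/
lemma coeff_lt_of_le {m x c K : ℕ} (h : c * x ≤ 2 * m) (hK : 2 * m < K * x) : c < K := by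
  by_contra! hc
  have := Nat.mul_le_mul_right x hc
  omega

set_option maxHeartbeats 4000000 in
/-- If `a₄` points at `a₂` or `a₃`, then at least four weights are even. -/
lemma four_even_of_pointer_ge_two {a₀ a₁ a₂ a₃ a₄ m : ℕ}
    (h0 : 0 < a₀) (h01 : a₀ ≤ a₁) (h12 : a₁ ≤ a₂) (h23 : a₂ ≤ a₃) (h34 : a₃ ≤ a₄) (h4m : a₄ < m)
    (hsum : a₀ + a₁ + a₂ + a₃ + a₄ = 3 * m) (hne : 3 * a₄ ≠ 2 * m)
    (h2 : 2 * m = 3 * a₂ ∨ 2 * m = 4 * a₂ ∨ 2 * m = a₀ + 2 * a₂ ∨ 2 * m = a₀ + 3 * a₂ ∨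
      2 * m = a₁ + 2 * a₂ ∨ 2 * m = a₁ + 3 * a₂ ∨ 2 * m = a₃ + 2 * a₂ ∨ 2 * m = a₄ + 2 * a₂)
    (h3 : 2 * m = 3 * a₃ ∨ 2 * m = a₀ + 2 * a₃ ∨ 2 * m = a₁ + 2 * a₃ ∨
      2 * m = a₂ + 2 * a₃ ∨ 2 * m = a₄ + 2 * a₃)
    (h4 : 2 * m = a₂ + 2 * a₄ ∨ 2 * m = a₃ + 2 * a₄) :
    a₀ % 2 + a₁ % 2 + a₂ % 2 + a₃ % 2 + a₄ % 2 + m % 2 ≤ 2 := by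
  replace h4 : 2 * m = a₂ + 2 * a₄ := by
    rcases h4 with h4 | h4
    · exact h4
    · rcases h3 with h3 | h3 | h3 | h3 | h3 <;> omega
  clear h3
  obtain ⟨h, h'⟩ : a₀ = a₁ ∧ a₁ = a₂ := by
    rcases h2 with h2 | h2 | h2 | h2 | h2 | h2 | h2 | h2 <;> omega
  have h'' : m = 2 * a₂ := by
    rcases h2 with h2 | h2 | h2 | h2 | h2 | h2 | h2 | h2 <;> omega
  have e : a₂ % 2 = 0 := by omega
  clear h0 h2 h01 h12 h23 h34 h4m hsum hne h4
  omega

set_option maxHeartbeats 4000000 in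
/-- The possible relations among the weights when `a₄` points at `a₁`. -/
lemma relations_of_pointer_one {a₀ a₁ a₂ a₃ a₄ m : ℕ}
    (h0 : 0 < a₀) (h01 : a₀ ≤ a₁) (h12 : a₁ ≤ a₂) (h23 : a₂ ≤ a₃) (h34 : a₃ ≤ a₄) (h4m : a₄ < m)
    (hsum : a₀ + a₁ + a₂ + a₃ + a₄ = 3 * m) (hne : 3 * a₄ ≠ 2 * m)
    (h2 : 2 * m = 3 * a₂ ∨ 2 * m = 4 * a₂ ∨ 2 * m = a₀ + 2 * a₂ ∨ 2 * m = a₀ + 3 * a₂ ∨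
      2 * m = a₁ + 2 * a₂ ∨ 2 * m = a₁ + 3 * a₂ ∨ 2 * m = a₃ + 2 * a₂ ∨ 2 * m = a₄ + 2 * a₂)
    (h3 : 2 * m = 3 * a₃ ∨ 2 * m = a₀ + 2 * a₃ ∨ 2 * m = a₁ + 2 * a₃ ∨
      2 * m = a₂ + 2 * a₃ ∨ 2 * m = a₄ + 2 * a₃)
    (h4 : 2 * m = a₁ + 2 * a₄)
    (h34eq : a₃ = a₄ → a₀ = a₁ ∨ a₁ = a₂ ∧ 2 * m = a₁ + 2 * a₄ ∨
      2 * m = a₀ + 3 * a₄ ∧ (2 * m = a₁ + 2 * a₄ ∨ 2 * m = a₂ + 2 * a₄)) :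
    2 * m = 3 * a₃ ∧ a₂ = a₃ ∨ 2 * m = 3 * a₃ ∧ 2 * m = a₄ + 2 * a₂ ∨
      2 * m = a₂ + 2 * a₃ ∧ 2 * m = a₄ + 2 * a₂ ∨ 2 * m = a₄ + 2 * a₃ ∧ a₂ = a₃ ∨
      a₀ = a₁ ∧ a₃ = a₄ ∧ (2 * m = 4 * a₂ ∨ 2 * m = 3 * a₂ ∨ 2 * m = a₃ + 2 * a₂) := by
  rcases h3 with h3 | h3 | h3 | h3 | h3
  · clear h34eq
    rcases h2 with h2 | h2 | h2 | h2 | h2 | h2 | h2 | h2 <;>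
      try (exfalso; omega)
    all_goals omega
  · clear h34eq
    rcases h2 with h2 | h2 | h2 | h2 | h2 | h2 | h2 | h2 <;>
      try (exfalso; omega)
    all_goals omega
  · replace h34eq : a₀ = a₁ ∨ a₁ = a₂ := by
      have := h34eq (by omega)
      omega
    rcases h34eq with h34eq | h34eq <;>
    rcases h2 with h2 | h2 | h2 | h2 | h2 | h2 | h2 | h2 <;>
      try (exfalso; omega)
    all_goals omega
  · clear h34eq
    rcases h2 with h2 | h2 | h2 | h2 | h2 | h2 | h2 | h2 <;>
      try (exfalso; omega)
    all_goals omega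
  · clear h34eq
    rcases h2 with h2 | h2 | h2 | h2 | h2 | h2 | h2 | h2 <;>
      try (exfalso; omega)
    all_goals omega

set_option maxHeartbeats 4000000 in
/-- The possible relations among the weights when `a₄` points at `a₀`. -/
lemma relations_of_pointer_zero {a₀ a₁ a₂ a₃ a₄ m : ℕ}
    (h01 : a₀ ≤ a₁) (h12 : a₁ ≤ a₂) (h23 : a₂ ≤ a₃) (h34 : a₃ ≤ a₄) (h4m : a₄ < m)
    (hsum : a₀ + a₁ + a₂ + a₃ + a₄ = 3 * m)
    (h2 : 2 * m = 3 * a₂ ∨ 2 * m = 4 * a₂ ∨ 2 * m = a₀ + 2 * a₂ ∨ 2 * m = a₀ + 3 * a₂ ∨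
      2 * m = a₁ + 2 * a₂ ∨ 2 * m = a₁ + 3 * a₂ ∨ 2 * m = a₃ + 2 * a₂ ∨ 2 * m = a₄ + 2 * a₂)
    (h3 : 2 * m = 3 * a₃ ∨ 2 * m = a₀ + 2 * a₃ ∨ 2 * m = a₁ + 2 * a₃ ∨
      2 * m = a₂ + 2 * a₃ ∨ 2 * m = a₄ + 2 * a₃)
    (h4 : 2 * m = a₀ + 2 * a₄)
    (h34eq : a₃ = a₄ → a₀ = a₁ ∨ a₁ = a₂ ∧ 2 * m = a₁ + 2 * a₄ ∨
      2 * m = a₀ + 3 * a₄ ∧ (2 * m = a₁ + 2 * a₄ ∨ 2 * m = a₂ + 2 * a₄)) :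
    2 * m = 3 * a₃ ∧ a₂ = a₃ ∨ 2 * m = 3 * a₃ ∧ 2 * m = a₄ + 2 * a₂ ∨
      2 * m = a₁ + 2 * a₃ ∧ (2 * m = 3 * a₂ ∨ 2 * m = a₀ + 3 * a₂ ∨ 2 * m = a₃ + 2 * a₂ ∨
        2 * m = a₄ + 2 * a₂) ∨
      2 * m = a₂ + 2 * a₃ ∧ (2 * m = a₀ + 3 * a₂ ∨ 2 * m = a₄ + 2 * a₂) ∨
      2 * m = a₄ + 2 * a₃ ∧ a₂ = a₃ ∨
      a₀ = a₁ ∧ a₃ = a₄ ∧ (2 * m = 4 * a₂ ∨ 2 * m = 3 * a₂ ∨ 2 * m = a₃ + 2 * a₂) := by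
  rcases h3 with h3 | h3 | h3 | h3 | h3
  · clear h34eq
    rcases h2 with h2 | h2 | h2 | h2 | h2 | h2 | h2 | h2 <;>
      try (exfalso; omega)
    all_goals omega
  · replace h34eq : a₀ = a₁ := by
      have := h34eq (by clear h34eq h2; omega)
      clear h2
      omega
    rcases h2 with h2 | h2 | h2 | h2 | h2 | h2 | h2 | h2 <;>
      try (exfalso; omega)
    all_goals omega
  · clear h34eq
    rcases h2 with h2 | h2 | h2 | h2 | h2 | h2 | h2 | h2 <;>
      try (exfalso; omega)
    all_goals omega
  · clear h34eq
    rcases h2 with h2 | h2 | h2 | h2 | h2 | h2 | h2 | h2 <;>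
      try (exfalso; omega)
    all_goals omega
  · clear h34eq
    rcases h2 with h2 | h2 | h2 | h2 | h2 | h2 | h2 | h2 <;>
      try (exfalso; omega)
    all_goals omega

set_option maxHeartbeats 4000000 in
/-- If `a₄` points at `a₁`, then at least four weights are even. -/
lemma four_even_of_pointer_one {a₀ a₁ a₂ a₃ a₄ m : ℕ}
    (h0 : 0 < a₀) (h01 : a₀ ≤ a₁) (h12 : a₁ ≤ a₂) (h23 : a₂ ≤ a₃) (h34 : a₃ ≤ a₄) (h4m : a₄ < m)
    (hsum : a₀ + a₁ + a₂ + a₃ + a₄ = 3 * m) (hne : 3 * a₄ ≠ 2 * m)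
    (h1 : 2 * m = 3 * a₁ ∨ 2 * m = 4 * a₁ ∨ 2 * m = 5 * a₁ ∨ 2 * m = 6 * a₁ ∨
      2 * m = a₀ + 3 * a₁ ∨ 2 * m = a₀ + 4 * a₁ ∨ 2 * m = a₀ + 5 * a₁ ∨
      2 * m = a₂ + 2 * a₁ ∨ 2 * m = a₂ + 3 * a₁ ∨ 2 * m = a₂ + 4 * a₁ ∨ 2 * m = a₂ + 5 * a₁ ∨
      2 * m = a₃ + 2 * a₁ ∨ 2 * m = a₃ + 3 * a₁ ∨ 2 * m = a₃ + 4 * a₁ ∨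
      2 * m = a₄ + 2 * a₁ ∨ 2 * m = a₄ + 3 * a₁ ∨ 2 * m = a₄ + 4 * a₁)
    (h2 : 2 * m = 3 * a₂ ∨ 2 * m = 4 * a₂ ∨ 2 * m = a₀ + 2 * a₂ ∨ 2 * m = a₀ + 3 * a₂ ∨
      2 * m = a₁ + 2 * a₂ ∨ 2 * m = a₁ + 3 * a₂ ∨ 2 * m = a₃ + 2 * a₂ ∨ 2 * m = a₄ + 2 * a₂)
    (h3 : 2 * m = 3 * a₃ ∨ 2 * m = a₀ + 2 * a₃ ∨ 2 * m = a₁ + 2 * a₃ ∨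
      2 * m = a₂ + 2 * a₃ ∨ 2 * m = a₄ + 2 * a₃)
    (h4 : 2 * m = a₁ + 2 * a₄)
    (h34eq : a₃ = a₄ → a₀ = a₁ ∨ a₁ = a₂ ∧ 2 * m = a₁ + 2 * a₄ ∨
      2 * m = a₀ + 3 * a₄ ∧ (2 * m = a₁ + 2 * a₄ ∨ 2 * m = a₂ + 2 * a₄)) :
    a₀ % 2 + a₁ % 2 + a₂ % 2 + a₃ % 2 + a₄ % 2 + m % 2 ≤ 2 := by
  have hrel := relations_of_pointer_one h0 h01 h12 h23 h34 h4m hsum hne h2 h3 h4 h34eq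
  clear h2 h3 h34eq
  have hpar : (a₀ + a₁ + a₂ + a₃ + a₄ + m) % 2 = 0 := by omega
  rcases hrel with ⟨h3, h2⟩ | ⟨h3, h2⟩ | ⟨h3, h2⟩ | ⟨h3, h2⟩ | ⟨h, h3, h2 | h2 | h2⟩
  case inr.inr.inr.inl =>
    replace h1 : 2 * m = 4 * a₁ ∨ 2 * m = a₀ + 3 * a₁ := by
      rcases h1 with h1 | h1 | h1 | h1 | h1 | h1 | h1 | h1 | h1 | h1 | h1 | h1 | h1 | h1 | h1 |
        h1 | h1 <;>
        try (exfalso; omega)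
      all_goals simp only [true_or, or_true, h1]
    clear h0 h01 h12 h23 h34 h4m hsum hne
    rcases h1 with h1 | h1 <;> omega
  all_goals
    clear h0 h01 h12 h23 h34 h4m hsum hne h1
    omega

set_option maxHeartbeats 4000000 in
/-- If `a₄` points at `a₀`, then at least four weights are even. -/
lemma four_even_of_pointer_zero {a₀ a₁ a₂ a₃ a₄ m : ℕ}
    (h01 : a₀ ≤ a₁) (h12 : a₁ ≤ a₂) (h23 : a₂ ≤ a₃) (h34 : a₃ ≤ a₄) (h4m : a₄ < m)
    (hsum : a₀ + a₁ + a₂ + a₃ + a₄ = 3 * m)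
    (h1 : 2 * m = 3 * a₁ ∨ 2 * m = 4 * a₁ ∨ 2 * m = 5 * a₁ ∨ 2 * m = 6 * a₁ ∨
      2 * m = a₀ + 3 * a₁ ∨ 2 * m = a₀ + 4 * a₁ ∨ 2 * m = a₀ + 5 * a₁ ∨
      2 * m = a₂ + 2 * a₁ ∨ 2 * m = a₂ + 3 * a₁ ∨ 2 * m = a₂ + 4 * a₁ ∨ 2 * m = a₂ + 5 * a₁ ∨
      2 * m = a₃ + 2 * a₁ ∨ 2 * m = a₃ + 3 * a₁ ∨ 2 * m = a₃ + 4 * a₁ ∨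
      2 * m = a₄ + 2 * a₁ ∨ 2 * m = a₄ + 3 * a₁ ∨ 2 * m = a₄ + 4 * a₁)
    (h2 : 2 * m = 3 * a₂ ∨ 2 * m = 4 * a₂ ∨ 2 * m = a₀ + 2 * a₂ ∨ 2 * m = a₀ + 3 * a₂ ∨
      2 * m = a₁ + 2 * a₂ ∨ 2 * m = a₁ + 3 * a₂ ∨ 2 * m = a₃ + 2 * a₂ ∨ 2 * m = a₄ + 2 * a₂)
    (h3 : 2 * m = 3 * a₃ ∨ 2 * m = a₀ + 2 * a₃ ∨ 2 * m = a₁ + 2 * a₃ ∨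
      2 * m = a₂ + 2 * a₃ ∨ 2 * m = a₄ + 2 * a₃)
    (h4 : 2 * m = a₀ + 2 * a₄)
    (h12eq : a₁ = a₂ → a₂ = a₃ → 2 * m ≠ a₄ + 2 * a₃)
    (h34eq : a₃ = a₄ → a₀ = a₁ ∨ a₁ = a₂ ∧ 2 * m = a₁ + 2 * a₄ ∨
      2 * m = a₀ + 3 * a₄ ∧ (2 * m = a₁ + 2 * a₄ ∨ 2 * m = a₂ + 2 * a₄)) :
    a₀ % 2 + a₁ % 2 + a₂ % 2 + a₃ % 2 + a₄ % 2 + m % 2 ≤ 2 := by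
  have hrel := relations_of_pointer_zero h01 h12 h23 h34 h4m hsum h2 h3 h4 h34eq
  clear h2 h3 h34eq
  have hpar : (a₀ + a₁ + a₂ + a₃ + a₄ + m) % 2 = 0 := by omega
  rcases hrel with ⟨h3, h2⟩ | ⟨h3, h2⟩ | ⟨h3, h2 | h2 | h2 | h2⟩ | ⟨h3, h2 | h2⟩ | ⟨h3, h2⟩ |
    ⟨h, h3, h2 | h2 | h2⟩
  case inr.inr.inr.inl.inl =>
    clear h12eq
    replace h1 : 2 * m = 4 * a₁ ∨ 2 * m = a₀ + 3 * a₁ ∨ 2 * m = a₂ + 3 * a₁ ∨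
        2 * m = a₄ + 2 * a₁ := by
      rcases h1 with h1 | h1 | h1 | h1 | h1 | h1 | h1 | h1 | h1 | h1 | h1 | h1 | h1 | h1 | h1 |
        h1 | h1 <;>
        try (exfalso; omega)
      all_goals simp only [true_or, or_true, h1]
    clear h01 h12 h23 h34 h4m hsum
    rcases h1 with h1 | h1 | h1 | h1 <;> omega
  case inr.inr.inr.inr.inl =>
    replace h1 : 2 * m = 4 * a₁ ∨ 2 * m = a₀ + 3 * a₁ := by
      replace h12eq : a₁ ≠ a₂ := fun h => h12eq h h2 (by omega)
      rcases h1 with h1 | h1 | h1 | h1 | h1 | h1 | h1 | h1 | h1 | h1 | h1 | h1 | h1 | h1 | h1 |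
        h1 | h1 <;>
        try (exfalso; omega)
      all_goals simp only [true_or, or_true, h1]
    clear h01 h12 h23 h34 h4m hsum h12eq
    rcases h1 with h1 | h1 <;> omega
  all_goals
    clear h01 h12 h23 h34 h4m hsum h1 h12eq
    omega

set_option maxHeartbeats 4000000 in
/-- The arithmetic core: the pointers of the weights, together with the condition on pairs of equal
weights, force at least four of the six weights to be even. -/
lemma four_even_of_pointers {a₀ a₁ a₂ a₃ a₄ m : ℕ} (h0 : 0 < a₀) (h01 : a₀ ≤ a₁) (h12 : a₁ ≤ a₂)
    (h23 : a₂ ≤ a₃) (h34 : a₃ ≤ a₄) (h4m : a₄ < m) (hsum : a₀ + a₁ + a₂ + a₃ + a₄ = 3 * m)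
    (hdvd : ¬ a₄ ∣ 2 * m)
    (h1 : ∃ c, 2 * m = c * a₁ ∨ 2 * m = a₀ + c * a₁ ∨ 2 * m = a₂ + c * a₁ ∨
      2 * m = a₃ + c * a₁ ∨ 2 * m = a₄ + c * a₁)
    (h2 : ∃ c, 2 * m = c * a₂ ∨ 2 * m = a₀ + c * a₂ ∨ 2 * m = a₁ + c * a₂ ∨
      2 * m = a₃ + c * a₂ ∨ 2 * m = a₄ + c * a₂)
    (h3 : ∃ c, 2 * m = c * a₃ ∨ 2 * m = a₀ + c * a₃ ∨ 2 * m = a₁ + c * a₃ ∨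
      2 * m = a₂ + c * a₃ ∨ 2 * m = a₄ + c * a₃)
    (h4 : ∃ c, 2 * m = c * a₄ ∨ 2 * m = a₀ + c * a₄ ∨ 2 * m = a₁ + c * a₄ ∨
      2 * m = a₂ + c * a₄ ∨ 2 * m = a₃ + c * a₄)
    (h12eq : a₁ = a₂ → (∃ c, 2 * m = c * a₁) ∨
      (∃ c, 2 * m = a₀ + c * a₁) ∧ (∃ c, 2 * m = a₃ + c * a₁) ∨
      (∃ c, 2 * m = a₀ + c * a₁) ∧ (∃ c, 2 * m = a₄ + c * a₁) ∨
      (∃ c, 2 * m = a₃ + c * a₁) ∧ (∃ c, 2 * m = a₄ + c * a₁))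
    (h34eq : a₃ = a₄ → (∃ c, 2 * m = a₀ + c * a₄) ∧ (∃ c, 2 * m = a₁ + c * a₄) ∨
      (∃ c, 2 * m = a₀ + c * a₄) ∧ (∃ c, 2 * m = a₂ + c * a₄) ∨
      (∃ c, 2 * m = a₁ + c * a₄) ∧ (∃ c, 2 * m = a₂ + c * a₄)) :
    a₀ % 2 + a₁ % 2 + a₂ % 2 + a₃ % 2 + a₄ % 2 + m % 2 ≤ 2 := by
  have hne : 3 * a₄ ≠ 2 * m := fun h => hdvd ⟨3, by omega⟩
  replace h4 : 2 * m = a₀ + 2 * a₄ ∨ 2 * m = a₁ + 2 * a₄ ∨ 2 * m = a₂ + 2 * a₄ ∨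
      2 * m = a₃ + 2 * a₄ := by
    obtain ⟨c, h⟩ := h4
    have hc : c < 4 := coeff_lt_of_le (m := m) (x := a₄) (by omega) (by omega)
    interval_cases c <;> omega
  replace h3 : 2 * m = 3 * a₃ ∨ 2 * m = a₀ + 2 * a₃ ∨ 2 * m = a₁ + 2 * a₃ ∨
      2 * m = a₂ + 2 * a₃ ∨ 2 * m = a₄ + 2 * a₃ := by
    obtain ⟨c, h⟩ := h3
    have hc : c < 4 := coeff_lt_of_le (m := m) (x := a₃) (by omega) (by omega)
    interval_cases c <;> omega
  have reduce (x : ℕ) (hx : x ≤ a₂) (h : ∃ c, 2 * m = x + c * a₄) :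
      2 * m = x + 2 * a₄ ∨ 2 * m = x + 3 * a₄ := by
    obtain ⟨c, h⟩ := h
    have hc : c < 4 := coeff_lt_of_le (m := m) (x := a₄) (by omega) (by omega)
    interval_cases c <;> omega
  replace h34eq : a₃ = a₄ → a₀ = a₁ ∨ a₁ = a₂ ∧ 2 * m = a₁ + 2 * a₄ ∨
      2 * m = a₀ + 3 * a₄ ∧ (2 * m = a₁ + 2 * a₄ ∨ 2 * m = a₂ + 2 * a₄) := by
    intro h
    rcases h34eq h with ⟨p, q⟩ | ⟨p, q⟩ | ⟨p, q⟩
    all_goals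
      have := reduce _ (by omega) p
      have := reduce _ (by omega) q
      omega
  replace h2 : 2 * m = 3 * a₂ ∨ 2 * m = 4 * a₂ ∨ 2 * m = a₀ + 2 * a₂ ∨ 2 * m = a₀ + 3 * a₂ ∨
      2 * m = a₁ + 2 * a₂ ∨ 2 * m = a₁ + 3 * a₂ ∨ 2 * m = a₃ + 2 * a₂ ∨ 2 * m = a₄ + 2 * a₂ := by
    obtain ⟨c, h⟩ := h2
    have hc : c < 6 := coeff_lt_of_le (m := m) (x := a₂) (by omega) (by omega)
    interval_cases c <;> omega
  have ha₁ : m ≤ 3 * a₁ := by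
    by_contra! hlt
    rcases h4 with h4 | h4 | h4 | h4 <;> rcases h3 with h3 | h3 | h3 | h3 | h3 <;>
      omega
  replace h12eq : 2 * m = a₀ + 2 * a₄ → a₁ = a₂ → a₂ = a₃ → 2 * m ≠ a₄ + 2 * a₃ := by
    clear h1 h2 h3 h4 h34eq
    intro h4 h h' h3
    have bound (y : ℕ) (h : ∃ c, 2 * m = y + c * a₁) : ∃ c < 7, 2 * m = y + c * a₁ := by
      obtain ⟨c, h⟩ := h
      exact ⟨c, coeff_lt_of_le (m := m) (x := a₁) (by omega) (by omega), h⟩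
    rcases h12eq h with h | ⟨h, -⟩ | ⟨h, -⟩ | ⟨h, -⟩
    · obtain ⟨c, hc, h⟩ := bound 0 (by simpa using h)
      interval_cases c <;> omega
    all_goals
      obtain ⟨c, hc, h⟩ := bound _ h
      interval_cases c <;> omega
  replace h1 : 2 * m = 3 * a₁ ∨ 2 * m = 4 * a₁ ∨ 2 * m = 5 * a₁ ∨ 2 * m = 6 * a₁ ∨
      2 * m = a₀ + 3 * a₁ ∨ 2 * m = a₀ + 4 * a₁ ∨ 2 * m = a₀ + 5 * a₁ ∨
      2 * m = a₂ + 2 * a₁ ∨ 2 * m = a₂ + 3 * a₁ ∨ 2 * m = a₂ + 4 * a₁ ∨ 2 * m = a₂ + 5 * a₁ ∨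
      2 * m = a₃ + 2 * a₁ ∨ 2 * m = a₃ + 3 * a₁ ∨ 2 * m = a₃ + 4 * a₁ ∨
      2 * m = a₄ + 2 * a₁ ∨ 2 * m = a₄ + 3 * a₁ ∨ 2 * m = a₄ + 4 * a₁ := by
    obtain ⟨c, h1⟩ := h1
    have hc : c < 7 := coeff_lt_of_le (m := m) (x := a₁) (by omega) (by omega)
    clear h2 h3 h4 h12eq h34eq hdvd reduce hne
    interval_cases c <;> omega
  rcases h4 with h4 | h4 | h4
  · exact four_even_of_pointer_zero h01 h12 h23 h34 h4m hsum h1 h2 h3 h4 (h12eq h4) h34eq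
  · exact four_even_of_pointer_one h0 h01 h12 h23 h34 h4m hsum hne h1 h2 h3 h4 h34eq
  · exact four_even_of_pointer_ge_two h0 h01 h12 h23 h34 h4m hsum hne h2 h3 h4

/-- If at least four of six weights are even, then some four weights share the factor two. -/
lemma exists_gcd_ne_one_of_four_even {a : Fin 6 → ℕ} (h : ∑ i, a i % 2 ≤ 2) :
    ∃ i j k l : Fin 6, i < j ∧ j < k ∧ k < l ∧
      Nat.gcd (a i) (Nat.gcd (a j) (Nat.gcd (a k) (a l))) ≠ 1 := by
  have hcard : 4 ≤ (Finset.univ.filter fun i => a i % 2 = 0).card := by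
    have hite (i : Fin 6) : (if a i % 2 = 0 then 1 else 0) = 1 - a i % 2 := by
      split_ifs <;> omega
    simp only [Finset.card_filter, hite, Fin.sum_univ_six] at h ⊢
    omega
  obtain ⟨s, hs, hs4⟩ := Finset.exists_subset_card_eq hcard
  let e := s.orderEmbOfFin hs4
  have heven (n : Fin 4) : 2 ∣ a (e n) :=
    Nat.dvd_of_mod_eq_zero (Finset.mem_filter.1 (hs (s.orderEmbOfFin_mem hs4 n))).2
  refine ⟨e 0, e 1, e 2, e 3, by simp, by simp, by simp, fun hgcd => ?_⟩
  have := Nat.dvd_gcd (heven 0) (Nat.dvd_gcd (heven 1) (Nat.dvd_gcd (heven 2) (heven 3)))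
  omega

/-- Under the numerical conditions for an FK3 weighted fourfold with singular
locus of dimension at most one and d = 2a₅, the weight a₄ divides d. -/
theorem stmt_16 (a : Fin 6 → ℕ) (d : ℕ)
    (hapos : ∀ i, 0 < a i) (hd : 0 < d) (hmono : Monotone a)
    (h5lt : a 5 < d) (hsum : ∑ i, a i = 2 * d) (hd5 : d = 2 * a 5)
    (hqs : QuasiSmoothCrit a d)
    (hgcd4 : ∀ i j k l : Fin 6, i < j → j < k → k < l →
      Nat.gcd (a i) (Nat.gcd (a j) (Nat.gcd (a k) (a l))) = 1)
    (hgcd3 : ∀ i j k : Fin 6, i < j → j < k →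
      Nat.gcd (a i) (Nat.gcd (a j) (a k)) ∣ d) :
    a 4 ∣ d := by
  by_contra hdvd
  have h01 : a 0 ≤ a 1 := hmono (by decide)
  have h12 : a 1 ≤ a 2 := hmono (by decide)
  have h23 : a 2 ≤ a 3 := hmono (by decide)
  have h34 : a 3 ≤ a 4 := hmono (by decide)
  have h45 : a 4 < a 5 := by
    refine lt_of_le_of_ne (hmono (by decide)) fun h => hdvd ?_
    rw [hd5, h]
    exact dvd_mul_left _ _
  have hsum' : a 0 + a 1 + a 2 + a 3 + a 4 = 3 * a 5 := by
    rw [Fin.sum_univ_six] at hsum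
    omega
  have pointer (i : Fin 6) : ∃ c, d = c * a i ∨ ∃ j, j ≠ i ∧ j ≠ 5 ∧ d = a j + c * a i :=
    hqs.exists_pointer hd5 i
  have h12eq := fun h : a 1 = a 2 => hqs.exists_pointers_of_eq hd5 (by decide) h
  have h34eq := fun h : a 4 = a 3 => hqs.exists_pointers_of_eq hd5 (by decide) h
  have hpar := four_even_of_pointers (hapos 0) h01 h12 h23 h34 h45 hsum' (hd5 ▸ hdvd)
    ?_ ?_ ?_ ?_ ?_ ?_
  · obtain ⟨i, j, k, l, hij, hjk, hkl, hne⟩ :=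
      exists_gcd_ne_one_of_four_even (a := a) (by rwa [Fin.sum_univ_six])
    exact hne (hgcd4 i j k l hij hjk hkl)
  · obtain ⟨c, h | ⟨j, h, h', h''⟩⟩ := pointer 1
    · exact ⟨c, by omega⟩
    · rw [← hd5]
      clear * - h h' h''
      fin_cases j <;> first | exact absurd rfl h | exact absurd rfl h' | exact ⟨c, by tauto⟩
  · obtain ⟨c, h | ⟨j, h, h', h''⟩⟩ := pointer 2
    · exact ⟨c, by omega⟩
    · rw [← hd5]
      clear * - h h' h''
      fin_cases j <;> first | exact absurd rfl h | exact absurd rfl h' | exact ⟨c, by tauto⟩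
  · obtain ⟨c, h | ⟨j, h, h', h''⟩⟩ := pointer 3
    · exact ⟨c, by omega⟩
    · rw [← hd5]
      clear * - h h' h''
      fin_cases j <;> first | exact absurd rfl h | exact absurd rfl h' | exact ⟨c, by tauto⟩
  · obtain ⟨c, h | ⟨j, h, h', h''⟩⟩ := pointer 4
    · exact ⟨c, by omega⟩
    · rw [← hd5]
      clear * - h h' h''
      fin_cases j <;> first | exact absurd rfl h | exact absurd rfl h' | exact ⟨c, by tauto⟩
  · intro h
    rw [← hd5]
    rcases h12eq h with h | ⟨j, l, hjl, hl5, hj1, hj2, hl1, hl2, hj, hl⟩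
    · exact .inl h
    · clear * - hjl hl5 hj1 hj2 hl1 hl2 hj hl
      fin_cases j <;> first | exact absurd rfl hj1 | exact absurd rfl hj2 | skip
      all_goals
        fin_cases l <;> first
          | exact absurd hjl (by decide) | exact absurd rfl hl1 | exact absurd rfl hl2
          | exact absurd rfl hl5 | tauto
  · intro h
    rw [← hd5]
    rcases h34eq h.symm with ⟨c, h⟩ | ⟨j, l, hjl, hl5, hj4, hj3, hl4, hl3, hj, hl⟩
    · exact absurd ⟨c, by rw [h, mul_comm]⟩ hdvd
    · clear * - h hjl hl5 hj4 hj3 hl4 hl3 hj hl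
      fin_cases j <;> first | exact absurd rfl hj3 | exact absurd rfl hj4 | skip
      all_goals
        fin_cases l <;> first
          | exact absurd hjl (by decide) | exact absurd rfl hl3 | exact absurd rfl hl4
          | exact absurd rfl hl5 | tauto
end
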